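/- Let $(M,g)$ be a smooth real 4-dimensional Lorentzian spin manifold of signature $(+,-,-,-)$ with Levi-Civita connection $\nabla$, and let $(o^A,\iota^A)$ be a smooth spin dyad on $M$ with $o_A\iota^A=1$ and null tetrad $l^a=o^A\bar o^{A'}$, $n^a=\iota^A\bar\iota^{A'}$, $m^a=o^A\bar\iota^{A'}$, $\bar m^a=\iota^A\bar o^{A'}$. The Riemann tensor is defined by $(\nabla_a\nabla_b-\nabla_b\nabla_a)V^d=R_{abc}{}^dV^c$, the Ricci tensor is $R_{ab}=R_{acb}{}^c$, and the Weyl spinor is $\Psi_{ABCD}=\tfrac14\bar\epsilon^{A'B'}\bar\epsilon^{C'D'}C_{AA'BB'CC'DD'}$ with $C_{abcd}$ the Weyl tensor; for a spinor $\Phi_{ABCD}=\Phi_{(ABCD)}$ let $\Phi_i$ denote its contraction with $4-i$ copies of $o^A$ and $i$ copies of $\iota^A$. Assume that $(M,g)$ is Einstein, $R_{ab}=6\Lambda g_{ab}$ with a real constant $\Lambda$, and of Petrov type II with repeated principal spinor $o^A$, i.e. $\Psi_0=\Psi_1=0$ and $\Psi_2\neq0$ everywhere. Put $\rho=m^a\bar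 m^b\nabla_bl_a$, $\tau=m^an^b\nabla_bl_a$, $\rho'=\bar m^am^b\nabla_bn_a$, $\tau'=\bar m^al^b\nabla_bn_a$, $\sigma'=\bar m^a\bar m^b\nabla_bn_a$ and $\omega(V)=\tfrac12(n^aV^b\nabla_bl_a+m^aV^b\nabla_b\bar m_a)$. On scalars $\eta$ of GHP weight $\{p,q\}$ (those with $\eta\mapsto\gamma^p\bar\gamma^q\eta$ under $o^A\mapsto\gamma o^A$, $\iota^A\mapsto\gamma^{-1}\iota^A$) the operators þ, þ', ð, ð' are $\eta\mapsto V\eta-p\,\omega(V)\eta-q\,\overline{\omega(\bar V)}\,\eta$ with $V=l,n,m,\bar m$ respectively; they change the weight by $\{1,1\}$, $\{-1,-1\}$, $\{1,-1\}$, $\{-1,1\}$. Let $\chi$ be a smooth complex scalar field of GHP weight $\{-4,0\}$ solving the Debye equation $$\mathcal O^\dagger\chi=2\big[(\text{þ}'-\bar\rho')(\text{þ}+3\rho)-(\text{ð}'-\bar\tau)(\text{ð}+3\tau)-3\Psi_2\big]\chi=0,$$ and let $h_{ab}=h_{nn}l_al_b-2h_{n\bar m}l_{(a}m_{b)}+h_{\bar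 m\bar m}m_am_b$, where $$h_{nn}=-(\text{ð}+2\tau)\text{ð}\chi-\bar\sigma'\text{þ}\chi,\quad h_{n\bar m}=-(\text{þ}+\rho)\text{ð}\chi-(\tau+\bar\tau')\text{þ}\chi,\quad h_{\bar m\bar m}=-(\text{þ}+2\rho)\text{þ}\chi .$$ Then the anti-self-dual linearized Weyl spinor of $h$, $$\dot\Psi_{ABCD}=\tfrac12\nabla_{(A}{}^{A'}\nabla_{B}{}^{B'}h_{CD)A'B'}+\tfrac14g^{ef}h_{ef}\Psi_{ABCD},$$ is of Petrov type N: $\dot\Psi_{ABCD}=o_Ao_Bo_Co_D\dot\Psi_4$, i.e. $\dot\Psi_0=\dot\Psi_1=\dot\Psi_2=\dot\Psi_3=0$. -/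

import Mathlib

open scoped Manifold ContDiff

noncomputable section

namespace Debye

/-! ### Smooth functions and complexified vector fields -/

section Manifold

variable (M : Type*) [TopologicalSpace M] [ChartedSpace (EuclideanSpace ℝ (Fin 4)) M]

/-- Multiplication of complex numbers is smooth over `ℝ`, so that smooth complex functions form
a ring. -/
instance instContMDiffRingComplex : ContMDiffRing 𝓘(ℝ, ℂ) ∞ ℂ :=
  { (inferInstance : ContMDiffAdd 𝓘(ℝ, ℂ) ∞ ℂ) with
    contMDiff_mul := by
      rw [← modelWithCornersSelf_prod, chartedSpaceSelf_prod]
      exact (contDiff_mul (𝕜 := ℝ) (𝔸 := ℂ) (n := ∞)).contMDiff }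

/-- The ring `C^∞(M, ℂ)` of smooth complex functions on the 4-manifold `M`. -/
abbrev Fn := C^∞⟮𝓡 4, M; 𝓘(ℝ, ℂ), ℂ⟯

/-- Smooth complex vector fields, i.e. sections of `TM ⊗ ℂ`, as derivations of `C^∞(M, ℂ)`.
(An `ℝ`-linear derivation of `C^∞(M, ℂ)` kills the constant `i`, hence is `ℂ`-linear; on a
Hausdorff second countable manifold these derivations are exactly the smooth complex vector fields.)
The Lie bracket is the commutator of derivations. -/
abbrev VF := Derivation ℝ (Fn M) (Fn M)

variable {M}

/-- Complex conjugation of functions. -/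
def Fn.conj (f : Fn M) : Fn M :=
  ⟨fun x => (starRingEnd ℂ) (f x),
    (Complex.conjCLE.contDiff (n := ∞)).contMDiff.comp f.contMDiff⟩

theorem Fn.conj_apply (f : Fn M) (x : M) : f.conj x = (starRingEnd ℂ) (f x) := rfl

theorem Fn.conj_add (f h : Fn M) : (f + h).conj = f.conj + h.conj := by
  ext x; simp [Fn.conj_apply]

theorem Fn.conj_mul (f h : Fn M) : (f * h).conj = f.conj * h.conj := by
  ext x; simp [Fn.conj_apply]

theorem Fn.conj_smul (c : ℝ) (f : Fn M) : (c • f).conj = c • f.conj := by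
  ext x; simp [Fn.conj_apply]

theorem Fn.conj_conj (f : Fn M) : f.conj.conj = f := by
  ext x; simp [Fn.conj_apply]

/-- Complex conjugation of complex vector fields, `X̄ f = conj (X (conj f))`.
A vector field is real if `X̄ = X`. -/
def VF.conj (X : VF M) : VF M :=
  Derivation.mk'
    { toFun := fun f => (X f.conj).conj
      map_add' := fun f h => by rw [Fn.conj_add, map_add, Fn.conj_add]
      map_smul' := fun c f => by
        rw [Fn.conj_smul, X.map_smul, Fn.conj_smul, RingHom.id_apply] }
    (fun f h => by
      change (X (f * h).conj).conj = f * (X h.conj).conj + h * (X f.conj).conj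
      rw [Fn.conj_mul, X.leibniz, smul_eq_mul, smul_eq_mul, Fn.conj_add, Fn.conj_mul,
        Fn.conj_mul, Fn.conj_conj, Fn.conj_conj])

variable (M)

/-- A smooth Lorentzian metric of signature `(+,-,-,-)`, extended complex bilinearly to complex
vector fields: a symmetric `C^∞(M, ℂ)`-bilinear form which is real on real vector fields and which,
at every point, is positive on some real vector and negative definite on the real vectors
orthogonal to it. -/
structure LorentzMetric where
  /-- the complex bilinear form `g_ab X^a Y^b` -/
  toForm : VF M →ₗ[Fn M] VF M →ₗ[Fn M] Fn M
  symm : ∀ X Y, toForm X Y = toForm Y X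
  real : ∀ X Y, toForm X.conj Y.conj = (toForm X Y).conj
  lorentzian : ∀ x : M, ∃ T : VF M, T.conj = T ∧ 0 < (toForm T T x).re ∧
    ∀ X : VF M, X.conj = X → toForm T X x = 0 → (∃ f : Fn M, X f x ≠ 0) →
      (toForm X X x).re < 0

variable {M}

/-- Components of `ε_{AB}`, `ε^{AB}`, `ε̄_{A'B'}`, `ε̄^{A'B'}` in a normalised dyad. -/
def eps : Fin 2 → Fin 2 → ℤ := ![![0, 1], ![-1, 0]]

/-- A spin dyad `(o^A, ι^A)`, `o_A ι^A = 1`, on the spacetime `(M, g)`, given through the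
identification `TM ⊗ ℂ ≅ S ⊗ S'`: with `ε_0 = o`, `ε_1 = ι`, the field `e A A'` is the vector field
`ε_A ε̄_{A'}`. Thus `e` is a hermitian frame of `TM ⊗ ℂ` with `g_{ab} = ε_{AB} ε̄_{A'B'}`, i.e. a
null tetrad `l = e 0 0`, `n = e 1 1`, `m = e 0 1`, `m̄ = e 1 0`; it trivialises the spin bundles, and
spinor fields are represented by their dyad components. -/
structure SpinDyad (g : LorentzMetric M) where
  /-- the frame `ε_A ε̄_{A'}` -/
  e : Fin 2 → Fin 2 → VF M
  hermitian : ∀ A A', (e A A').conj = e A' A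
  gram : ∀ A A' B B', g.toForm (e A A') (e B B') = ((eps A B * eps A' B' : ℤ) : Fn M)
  spans : ⊤ ≤ Submodule.span (Fn M) (Set.range fun p : Fin 2 × Fin 2 => e p.1 p.2)

end Manifold

namespace SpinDyad

variable {M : Type*} [TopologicalSpace M] [ChartedSpace (EuclideanSpace ℝ (Fin 4)) M]
  {g : LorentzMetric M} (S : SpinDyad g)

/-- `l^a = o^A ō^{A'}` -/
def l : VF M := S.e 0 0
/-- `n^a = ι^A ῑ^{A'}` -/
def n : VF M := S.e 1 1
/-- `m^a = o^A ῑ^{A'}` -/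
def m : VF M := S.e 0 1
/-- `m̄^a = ι^A ō^{A'}` -/
def mb : VF M := S.e 1 0

/-! ### Levi-Civita connection and curvature -/

/-- The Koszul expression, equal to `g(∇_X Y, Z)` for the Levi-Civita connection `∇`. -/
def koszul (g : LorentzMetric M) (X Y Z : VF M) : Fn M :=
  (1 / 2 : ℝ) • (X (g.toForm Y Z) + Y (g.toForm X Z) - Z (g.toForm X Y)
    + g.toForm ⁅X, Y⁆ Z - g.toForm ⁅X, Z⁆ Y - g.toForm ⁅Y, Z⁆ X)

/-- The Levi-Civita connection: `∇_X Y` is the vector field with `g(∇_X Y, Z) = koszul g X Y Z`,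
obtained by raising the index with `g^{ab} = ε^{AB} ε̄^{A'B'}`. -/
def nabla (X Y : VF M) : VF M :=
  ∑ A, ∑ A', ∑ B, ∑ B',
    (((eps A B * eps A' B' : ℤ) : Fn M) * koszul g X Y (S.e A A')) • S.e B B'

/-- The Riemann tensor `R_{abcd} X^a Y^b Z^c W^d`, with the convention
`(∇_a ∇_b - ∇_b ∇_a) Z^d = R_{abc}{}^d Z^c`. -/
def riemann (X Y Z W : VF M) : Fn M :=
  g.toForm (S.nabla X (S.nabla Y Z) - S.nabla Y (S.nabla X Z) - S.nabla ⁅X, Y⁆ Z) W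

/-- The Ricci tensor `R_{ab} = R_{acb}{}^c`. -/
def ricci (X Y : VF M) : Fn M :=
  ∑ A, ∑ A', ∑ B, ∑ B',
    ((eps A B * eps A' B' : ℤ) : Fn M) * S.riemann X (S.e A A') Y (S.e B B')

/-- The scalar curvature `R = g^{ab} R_{ab}`. -/
def scalarCurv : Fn M :=
  ∑ A, ∑ A', ∑ B, ∑ B', ((eps A B * eps A' B' : ℤ) : Fn M) * S.ricci (S.e A A') (S.e B B')

/-- The Weyl tensor `C_{abcd}`, the trace-free part of `R_{abcd}`. -/
def weyl (X Y Z W : VF M) : Fn M :=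
  S.riemann X Y Z W
    - (1 / 2 : ℝ) • (g.toForm X Z * S.ricci Y W - g.toForm X W * S.ricci Y Z
        - g.toForm Y Z * S.ricci X W + g.toForm Y W * S.ricci X Z)
    + (1 / 6 : ℝ) • (S.scalarCurv * (g.toForm X Z * g.toForm Y W - g.toForm X W * g.toForm Y Z))

/-- Dyad components of the Weyl spinor
`Ψ_{ABCD} = ¼ ε̄^{A'B'} ε̄^{C'D'} C_{AA'BB'CC'DD'}`; the index of a spinor with four lower indices is
`i : Fin 4 → Fin 2`, where the value `0` stands for contraction with `o` and `1` with `ι`. -/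
def Psi (i : Fin 4 → Fin 2) : Fn M :=
  (1 / 4 : ℝ) • ∑ A', ∑ B', ∑ C', ∑ D', ((eps A' B' * eps C' D' : ℤ) : Fn M) *
    S.weyl (S.e (i 0) A') (S.e (i 1) B') (S.e (i 2) C') (S.e (i 3) D')

/-- The Weyl scalar `Ψ₂ = Ψ_{ABCD} o^A o^B ι^C ι^D`. -/
def Psi2 : Fn M := S.Psi ![0, 0, 1, 1]

/-- Einstein condition with constant `Λ = R/24`: the trace-free Ricci tensor vanishes,
`R_{ab} = 6 Λ g_{ab}`. -/
def IsEinstein (Λ : ℝ) : Prop :=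
  ∀ X Y : VF M, S.ricci X Y = (6 * Λ) • g.toForm X Y

/-- Petrov type II with repeated principal spinor `o^A`: `Ψ₀ = Ψ₁ = 0` and `Ψ₂` vanishes nowhere. -/
def IsTypeII : Prop :=
  S.Psi ![0, 0, 0, 0] = 0 ∧ S.Psi ![0, 0, 0, 1] = 0 ∧ ∀ x : M, S.Psi2 x ≠ 0

/-! ### Spin coefficients and GHP operators -/

/-- `ρ = m^a m̄^b ∇_b l_a` -/
def rho : Fn M := g.toForm S.m (S.nabla S.mb S.l)
/-- `τ = m^a n^b ∇_b l_a` -/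
def tau : Fn M := g.toForm S.m (S.nabla S.n S.l)
/-- `ρ' = m̄^a m^b ∇_b n_a` -/
def rho' : Fn M := g.toForm S.mb (S.nabla S.m S.n)
/-- `τ' = m̄^a l^b ∇_b n_a` -/
def tau' : Fn M := g.toForm S.mb (S.nabla S.l S.n)
/-- `σ' = m̄^a m̄^b ∇_b n_a` -/
def sigma' : Fn M := g.toForm S.mb (S.nabla S.mb S.n)

/-- The coefficient `ω(V)` in `V^b ∇_b o^A = ω(V) o^A + (…) ι^A`, that is
`½ (n^a V^b ∇_b l_a + m^a V^b ∇_b m̄_a)`. Its values on `l, m, m̄, n` are the Newman–Penrose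
coefficients `ε, β, α = -β', γ = -ε'`. -/
def spinConn (V : VF M) : Fn M :=
  (1 / 2 : ℝ) • (g.toForm S.n (S.nabla V S.l) + g.toForm S.m (S.nabla V S.mb))

/-- The GHP derivative of a scalar `η` of weight `{p, q}` along `V`:
`V η - p ω(V) η - q conj (ω (V̄)) η` with `ω = spinConn`. -/
def ghp (V : VF M) (p q : ℤ) (η : Fn M) : Fn M :=
  V η - (p : Fn M) * S.spinConn V * η - (q : Fn M) * (S.spinConn V.conj).conj * η

/-- `þ` on weight `{p, q}`; the result has weight `{p + 1, q + 1}`. -/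
def tho (p q : ℤ) (η : Fn M) : Fn M := S.ghp S.l p q η
/-- `þ'` on weight `{p, q}`; the result has weight `{p - 1, q - 1}`. -/
def tho' (p q : ℤ) (η : Fn M) : Fn M := S.ghp S.n p q η
/-- `ð` on weight `{p, q}`; the result has weight `{p + 1, q - 1}`. -/
def edt (p q : ℤ) (η : Fn M) : Fn M := S.ghp S.m p q η
/-- `ð'` on weight `{p, q}`; the result has weight `{p - 1, q + 1}`. -/
def edt' (p q : ℤ) (η : Fn M) : Fn M := S.ghp S.mb p q η

/-! ### The Debye equation and the Debye metric -/

/-- `O†χ = 2[(þ' - ρ̄')(þ + 3ρ) - (ð' - τ̄)(ð + 3τ) - 3Ψ₂]χ` on weight `{-4, 0}`. -/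
def debyeOp (χ : Fn M) : Fn M :=
  let u := S.tho (-4) 0 χ + 3 * S.rho * χ
  let v := S.edt (-4) 0 χ + 3 * S.tau * χ
  2 * ((S.tho' (-3) 1 u - S.rho'.conj * u)
    - (S.edt' (-3) (-1) v - S.tau.conj * v) - 3 * S.Psi2 * χ)

/-- `h_nn = -(ð + 2τ)ðχ - σ̄'þχ` -/
def hnn (χ : Fn M) : Fn M :=
  -(S.edt (-3) (-1) (S.edt (-4) 0 χ) + 2 * S.tau * S.edt (-4) 0 χ)
    - S.sigma'.conj * S.tho (-4) 0 χ

/-- `h_nm̄ = -(þ + ρ)ðχ - (τ + τ̄')þχ` -/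
def hnmb (χ : Fn M) : Fn M :=
  -(S.tho (-3) (-1) (S.edt (-4) 0 χ) + S.rho * S.edt (-4) 0 χ)
    - (S.tau + S.tau'.conj) * S.tho (-4) 0 χ

/-- `h_m̄m̄ = -(þ + 2ρ)þχ` -/
def hmbmb (χ : Fn M) : Fn M :=
  -(S.tho (-3) 1 (S.tho (-4) 0 χ) + 2 * S.rho * S.tho (-4) 0 χ)

/-- The Debye metric `h_ab = S†(χ)_ab = h_nn l_a l_b - 2 h_nm̄ l_(a m_b) + h_m̄m̄ m_a m_b`. -/
def debyeMetric (χ : Fn M) (X Y : VF M) : Fn M :=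
  S.hnn χ * (g.toForm S.l X * g.toForm S.l Y)
    - S.hnmb χ * (g.toForm S.l X * g.toForm S.m Y + g.toForm S.m X * g.toForm S.l Y)
    + S.hmbmb χ * (g.toForm S.m X * g.toForm S.m Y)

/-! ### The linearized anti-self-dual Weyl spinor -/

/-- `∇_b h_{cd} Y^b Z^c W^d` for a 2-tensor `h`. -/
def nablaTwo (h : VF M → VF M → Fn M) (Y Z W : VF M) : Fn M :=
  Y (h Z W) - h (S.nabla Y Z) W - h Z (S.nabla Y W)

/-- `∇_a t_{bcd} X^a Y^b Z^c W^d` for a 3-tensor `t`. -/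
def nablaThree (t : VF M → VF M → VF M → Fn M) (X Y Z W : VF M) : Fn M :=
  X (t Y Z W) - t (S.nabla X Y) Z W - t Y (S.nabla X Z) W - t Y Z (S.nabla X W)

/-- `g^{ef} h_{ef}` -/
def traceTwo (h : VF M → VF M → Fn M) : Fn M :=
  ∑ A, ∑ A', ∑ B, ∑ B', ((eps A B * eps A' B' : ℤ) : Fn M) * h (S.e A A') (S.e B B')

/-- Total symmetrization `T_{(ABCD)}`. -/
def sym4 (T : (Fin 4 → Fin 2) → Fn M) (i : Fin 4 → Fin 2) : Fn M :=
  (1 / 24 : ℝ) • ∑ π : Equiv.Perm (Fin 4), T (i ∘ π)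

/-- Dyad components of `∇_A{}^{A'} ∇_B{}^{B'} h_{CDA'B'}`, where `h_{CDA'B'} = h_{CA'DB'}` and
primed indices are raised by `φ^{A'} = ε̄^{A'P'} φ_{P'}`. -/
def nablaNablaContr (h : VF M → VF M → Fn M) (i : Fin 4 → Fin 2) : Fn M :=
  ∑ A', ∑ P', ∑ B', ∑ Q', ((eps A' P' * eps B' Q' : ℤ) : Fn M) *
    S.nablaThree (S.nablaTwo h) (S.e (i 0) P') (S.e (i 1) Q') (S.e (i 2) A') (S.e (i 3) B')

/-- Dyad components of the anti-self-dual linearized Weyl spinor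
`Ψ̇_{ABCD} = ½ ∇_{(A}{}^{A'} ∇_B{}^{B'} h_{CD)A'B'} + ¼ g^{ef} h_{ef} Ψ_{ABCD}`. -/
def linWeyl (h : VF M → VF M → Fn M) (i : Fin 4 → Fin 2) : Fn M :=
  (1 / 2 : ℝ) • sym4 (S.nablaNablaContr h) i + (1 / 4 : ℝ) • (S.traceTwo h * S.Psi i)

/-- Dyad components of `o_A`: `o_A o^A = 0`, `o_A ι^A = 1`. -/
def oLower : Fin 2 → ℤ := ![0, 1]

end SpinDyad

end Debye

end

noncomputable section

namespace Debye

/-! ### Smooth functions, vector fields and conjugation -/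

section Basic

variable {M : Type*} [TopologicalSpace M] [ChartedSpace (EuclideanSpace ℝ (Fin 4)) M]

theorem Fn.two_mul_half_smul (f : Fn M) : 2 * ((1 / 2 : ℝ) • f) = f := by
  have h : (2 : Fn M) = algebraMap ℝ (Fn M) 2 := (map_ofNat _ _).symm
  rw [h, ← Algebra.smul_def, smul_smul]
  norm_num

theorem Fn.two_mul_cancel {f h : Fn M} (H : 2 * f = 2 * h) : f = h := by
  have := congrArg (fun k => (1 / 2 : ℝ) • k) H
  simpa only [← mul_smul_comm, Fn.two_mul_half_smul] using this

theorem Fn.conj_neg (f : Fn M) : (-f).conj = -f.conj := by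
  ext x; simp [Fn.conj_apply]

theorem Fn.conj_sub (f h : Fn M) : (f - h).conj = f.conj - h.conj := by
  rw [sub_eq_add_neg, Fn.conj_add, Fn.conj_neg, sub_eq_add_neg]

theorem Fn.conj_zero : (0 : Fn M).conj = 0 := by
  ext x; simp [Fn.conj_apply]

theorem Fn.conj_ofNat (k : ℕ) [k.AtLeastTwo] :
    (ofNat(k) : Fn M).conj = ofNat(k) := by
  ext x
  rw [Fn.conj_apply]
  have h : (OfNat.ofNat k : Fn M) = algebraMap ℝ (Fn M) (OfNat.ofNat k) := (map_ofNat _ _).symm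
  rw [h]
  exact Complex.conj_ofReal _

theorem Fn.conj_algebraMap (c : ℝ) : (algebraMap ℝ (Fn M) c).conj = algebraMap ℝ (Fn M) c := by
  ext x
  exact Complex.conj_ofReal c

theorem VF.conj_apply (X : VF M) (f : Fn M) : X.conj f = (X f.conj).conj := rfl

theorem VF.conj_conj (X : VF M) : X.conj.conj = X := by
  ext1 f
  rw [VF.conj_apply, VF.conj_apply, Fn.conj_conj, Fn.conj_conj]

theorem VF.conj_add (X Y : VF M) : (X + Y).conj = X.conj + Y.conj := by
  ext1 f
  simp only [VF.conj_apply, Derivation.add_apply, Fn.conj_add]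

theorem VF.conj_smul (f : Fn M) (X : VF M) : (f • X).conj = f.conj • X.conj := by
  ext1 h
  simp only [VF.conj_apply, Derivation.smul_apply, smul_eq_mul, Fn.conj_mul]

theorem VF.conj_lie (X Y : VF M) : (⁅X, Y⁆ : VF M).conj = ⁅X.conj, Y.conj⁆ := by
  ext1 f
  simp only [VF.conj_apply, Derivation.commutator_apply, Fn.conj_sub, Fn.conj_conj]

theorem VF.lie_add' (X Y Z : VF M) : ⁅X, Y + Z⁆ = ⁅X, Y⁆ + ⁅X, Z⁆ := by
  ext1 h
  simp only [Derivation.commutator_apply, Derivation.add_apply, map_add]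
  ring

theorem VF.add_lie' (X Y Z : VF M) : ⁅X + Y, Z⁆ = ⁅X, Z⁆ + ⁅Y, Z⁆ := by
  ext1 h
  simp only [Derivation.commutator_apply, Derivation.add_apply, map_add]
  ring

theorem VF.lie_skew' (X Y : VF M) : -⁅Y, X⁆ = ⁅X, Y⁆ := by
  ext1 h
  simp only [Derivation.commutator_apply, Derivation.neg_apply]
  ring

theorem VF.lie_neg' (X Y : VF M) : ⁅X, -Y⁆ = -⁅X, Y⁆ := by
  ext1 h
  simp only [Derivation.commutator_apply, Derivation.neg_apply, map_neg]
  ring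

theorem VF.neg_lie' (X Y : VF M) : ⁅-X, Y⁆ = -⁅X, Y⁆ := by
  ext1 h
  simp only [Derivation.commutator_apply, Derivation.neg_apply, map_neg]
  ring

theorem VF.neg_fn_smul (f : Fn M) (X : VF M) : (-f) • X = -(f • X) := by
  ext1 h
  simp only [Derivation.smul_apply, Derivation.neg_apply, smul_eq_mul]
  ring

theorem VF.lie_fn_smul (X Y : VF M) (f : Fn M) : ⁅X, f • Y⁆ = f • ⁅X, Y⁆ + X f • Y := by
  ext1 h
  simp only [Derivation.commutator_apply, Derivation.smul_apply, Derivation.add_apply,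
    smul_eq_mul, Derivation.leibniz]
  ring

theorem VF.fn_smul_lie (X Y : VF M) (f : Fn M) : ⁅f • X, Y⁆ = f • ⁅X, Y⁆ - Y f • X := by
  ext1 h
  simp only [Derivation.commutator_apply, Derivation.smul_apply, Derivation.sub_apply,
    smul_eq_mul, Derivation.leibniz]
  ring

theorem VF.apply_mul (X : VF M) (f h : Fn M) : X (f * h) = X f * h + f * X h := by
  rw [X.leibniz, smul_eq_mul, smul_eq_mul]; ring

theorem VF.apply_ofNat (X : VF M) (k : ℕ) [k.AtLeastTwo] : X (ofNat(k) : Fn M) = 0 := by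
  have h : (OfNat.ofNat k : Fn M) = ((k : ℕ) : Fn M) := rfl
  rw [h, X.map_natCast]

theorem VF.apply_ofNat_mul (X : VF M) (k : ℕ) [k.AtLeastTwo] (f : Fn M) :
    X (ofNat(k) * f) = ofNat(k) * X f := by
  rw [VF.apply_mul, VF.apply_ofNat, zero_mul, zero_add]

/-! ### The Koszul formula -/

variable {g : LorentzMetric M}

namespace SpinDyad

theorem two_mul_koszul (X Y Z : VF M) : 2 * koszul g X Y Z =
    X (g.toForm Y Z) + Y (g.toForm X Z) - Z (g.toForm X Y)
    + g.toForm ⁅X, Y⁆ Z - g.toForm ⁅X, Z⁆ Y - g.toForm ⁅Y, Z⁆ X :=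
  Fn.two_mul_half_smul _

theorem koszul_add_right (X Y Z W : VF M) :
    koszul g X Y (Z + W) = koszul g X Y Z + koszul g X Y W := by
  apply Fn.two_mul_cancel
  rw [mul_add]
  simp only [two_mul_koszul, map_add, VF.lie_add', LinearMap.add_apply, Derivation.add_apply]
  ring

theorem koszul_smul_right (X Y Z : VF M) (f : Fn M) :
    koszul g X Y (f • Z) = f * koszul g X Y Z := by
  apply Fn.two_mul_cancel
  rw [mul_left_comm]
  simp only [two_mul_koszul, map_add, map_smul, VF.lie_fn_smul, LinearMap.add_apply,
    Derivation.smul_apply, smul_eq_mul, VF.apply_mul, LinearMap.smul_apply]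
  rw [g.symm Z X, g.symm Z Y]
  ring

theorem koszul_add_middle (X Y Y' Z : VF M) :
    koszul g X (Y + Y') Z = koszul g X Y Z + koszul g X Y' Z := by
  apply Fn.two_mul_cancel
  rw [mul_add]
  simp only [two_mul_koszul, map_add, VF.lie_add', VF.add_lie', LinearMap.add_apply, Derivation.add_apply]
  ring

theorem koszul_smul_middle (X Y Z : VF M) (f : Fn M) :
    koszul g X (f • Y) Z = f * koszul g X Y Z + X f * g.toForm Y Z := by
  apply Fn.two_mul_cancel
  rw [mul_add, mul_left_comm]
  simp only [two_mul_koszul, map_add, map_sub, map_smul, VF.lie_fn_smul, VF.fn_smul_lie,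
    LinearMap.add_apply, LinearMap.sub_apply,
    Derivation.smul_apply, smul_eq_mul, VF.apply_mul, LinearMap.smul_apply]
  rw [g.symm Y X]
  ring

theorem koszul_add_left (X X' Y Z : VF M) :
    koszul g (X + X') Y Z = koszul g X Y Z + koszul g X' Y Z := by
  apply Fn.two_mul_cancel
  rw [mul_add]
  simp only [two_mul_koszul, map_add, VF.add_lie', LinearMap.add_apply, Derivation.add_apply]
  ring

theorem koszul_smul_left (X Y Z : VF M) (f : Fn M) :
    koszul g (f • X) Y Z = f * koszul g X Y Z := by
  apply Fn.two_mul_cancel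
  rw [mul_left_comm]
  simp only [two_mul_koszul, map_sub, map_smul, VF.fn_smul_lie, LinearMap.sub_apply,
    Derivation.smul_apply, smul_eq_mul, VF.apply_mul, LinearMap.smul_apply]
  ring

theorem koszul_conj (X Y Z : VF M) :
    koszul g X.conj Y.conj Z.conj = (koszul g X Y Z).conj := by
  apply Fn.two_mul_cancel
  have : 2 * (koszul g X Y Z).conj = (2 * koszul g X Y Z).conj := by
    rw [Fn.conj_mul, Fn.conj_ofNat]
  rw [this]
  simp only [two_mul_koszul, ← VF.conj_lie, g.real, VF.conj_apply, Fn.conj_conj, Fn.conj_add,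
    Fn.conj_sub]

variable (S : SpinDyad g)

/-! ### The frame -/

theorem sum_eps (F : Fin 2 → Fin 2 → Fin 2 → Fin 2 → Fn M) :
    ∑ A, ∑ A', ∑ B, ∑ B', ((eps A B * eps A' B' : ℤ) : Fn M) * F A A' B B' =
      F 0 0 1 1 + F 1 1 0 0 - F 0 1 1 0 - F 1 0 0 1 := by
  simp [Fin.sum_univ_two, eps]
  ring

theorem form_ll : g.toForm S.l S.l = 0 := by simp [l, S.gram, eps]
theorem form_ln : g.toForm S.l S.n = 1 := by simp [l, n, S.gram, eps]
theorem form_lm : g.toForm S.l S.m = 0 := by simp [l, m, S.gram, eps]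
theorem form_lmb : g.toForm S.l S.mb = 0 := by simp [l, mb, S.gram, eps]
theorem form_nl : g.toForm S.n S.l = 1 := by simp [l, n, S.gram, eps]
theorem form_nn : g.toForm S.n S.n = 0 := by simp [n, S.gram, eps]
theorem form_nm : g.toForm S.n S.m = 0 := by simp [n, m, S.gram, eps]
theorem form_nmb : g.toForm S.n S.mb = 0 := by simp [n, mb, S.gram, eps]
theorem form_ml : g.toForm S.m S.l = 0 := by simp [l, m, S.gram, eps]
theorem form_mn : g.toForm S.m S.n = 0 := by simp [m, n, S.gram, eps]
theorem form_mm : g.toForm S.m S.m = 0 := by simp [m, S.gram, eps]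
theorem form_mmb : g.toForm S.m S.mb = -1 := by simp [m, mb, S.gram, eps]
theorem form_mbl : g.toForm S.mb S.l = 0 := by simp [l, mb, S.gram, eps]
theorem form_mbn : g.toForm S.mb S.n = 0 := by simp [mb, n, S.gram, eps]
theorem form_mbm : g.toForm S.mb S.m = -1 := by simp [m, mb, S.gram, eps]
theorem form_mbmb : g.toForm S.mb S.mb = 0 := by simp [mb, S.gram, eps]

theorem conj_l : S.l.conj = S.l := S.hermitian 0 0
theorem conj_n : S.n.conj = S.n := S.hermitian 1 1
theorem conj_m : S.m.conj = S.mb := S.hermitian 0 1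
theorem conj_mb : S.mb.conj = S.m := S.hermitian 1 0

theorem frame_induction {p : VF M → Prop} (hl : p S.l) (hn : p S.n) (hm : p S.m) (hmb : p S.mb)
    (hadd : ∀ X Y, p X → p Y → p (X + Y)) (hsmul : ∀ (f : Fn M) X, p X → p (f • X)) (X : VF M) :
    p X := by
  have hX : X ∈ Submodule.span (Fn M) (Set.range fun q : Fin 2 × Fin 2 => S.e q.1 q.2) :=
    S.spans Submodule.mem_top
  have h0 : p 0 := by simpa using hsmul 0 _ hl
  induction hX using Submodule.span_induction with
  | mem Y hY =>
    obtain ⟨⟨A, A'⟩, rfl⟩ := hY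
    fin_cases A <;> fin_cases A' <;> assumption
  | zero => exact h0
  | add Y Z _ _ hY hZ => exact hadd Y Z hY hZ
  | smul f Y _ hY => exact hsmul f Y hY

theorem frame_expansion (X : VF M) :
    X = g.toForm S.n X • S.l + g.toForm S.l X • S.n - g.toForm S.mb X • S.m
      - g.toForm S.m X • S.mb := by
  refine S.frame_induction (p := fun X => X = g.toForm S.n X • S.l + g.toForm S.l X • S.n
    - g.toForm S.mb X • S.m - g.toForm S.m X • S.mb) ?_ ?_ ?_ ?_ ?_ ?_ X
  · simp [form_nl, form_ll, form_mbl, form_ml]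
  · simp [form_nn, form_ln, form_mbn, form_mn]
  · simp [form_nm, form_lm, form_mbm, form_mm, VF.neg_fn_smul]
  · simp [form_nmb, form_lmb, form_mbmb, form_mmb, VF.neg_fn_smul]
  · intro Y Z hY hZ
    simp only [map_add, add_smul]
    nth_rewrite 1 [hY]
    nth_rewrite 1 [hZ]
    abel
  · intro f Y hY
    simp only [map_smul, smul_eq_mul, mul_smul, ← smul_add, ← smul_sub]
    rw [← hY]

theorem frame_ext (S : SpinDyad g) {X Y : VF M} (hl : g.toForm X S.l = g.toForm Y S.l)
    (hn : g.toForm X S.n = g.toForm Y S.n) (hm : g.toForm X S.m = g.toForm Y S.m)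
    (hmb : g.toForm X S.mb = g.toForm Y S.mb) : X = Y := by
  rw [S.frame_expansion X, S.frame_expansion Y, g.symm _ X, g.symm _ X, g.symm _ X, g.symm _ X,
    hl, hn, hm, hmb, g.symm _ Y, g.symm _ Y, g.symm _ Y, g.symm _ Y]

theorem form_ext (S : SpinDyad g) {X Y : VF M} (h : ∀ Z, g.toForm X Z = g.toForm Y Z) : X = Y :=
  S.frame_ext (h _) (h _) (h _) (h _)

/-! ### The Levi-Civita connection -/

theorem nabla_eq (X Y : VF M) : S.nabla X Y = koszul g X Y S.l • S.n + koszul g X Y S.n • S.l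
    - koszul g X Y S.m • S.mb - koszul g X Y S.mb • S.m := by
  simp [nabla, Fin.sum_univ_two, eps, l, n, m, mb, VF.neg_fn_smul]
  abel

theorem form_nabla (X Y Z : VF M) : g.toForm (S.nabla X Y) Z = koszul g X Y Z := by
  refine S.frame_induction (p := fun Z => g.toForm (S.nabla X Y) Z = koszul g X Y Z)
    ?_ ?_ ?_ ?_ ?_ ?_ Z
  · simp [nabla_eq, form_ll, form_nl, form_ml, form_mbl]
  · simp [nabla_eq, form_ln, form_nn, form_mn, form_mbn]
  · simp [nabla_eq, form_lm, form_nm, form_mm, form_mbm]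
  · simp [nabla_eq, form_lmb, form_nmb, form_mmb, form_mbmb]
  · intro Z W hZ hW
    rw [map_add, hZ, hW, koszul_add_right]
  · intro f Z hZ
    rw [map_smul, hZ, koszul_smul_right, smul_eq_mul]

theorem nabla_add_left (X X' Y : VF M) : S.nabla (X + X') Y = S.nabla X Y + S.nabla X' Y :=
  S.form_ext fun Z => by
    simp only [map_add, LinearMap.add_apply, form_nabla, koszul_add_left]

theorem nabla_smul_left (f : Fn M) (X Y : VF M) : S.nabla (f • X) Y = f • S.nabla X Y :=
  S.form_ext fun Z => by
    simp only [map_smul, LinearMap.smul_apply, form_nabla, koszul_smul_left, smul_eq_mul]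

theorem nabla_add_right (X Y Y' : VF M) : S.nabla X (Y + Y') = S.nabla X Y + S.nabla X Y' :=
  S.form_ext fun Z => by
    simp only [map_add, LinearMap.add_apply, form_nabla, koszul_add_middle]

theorem nabla_smul_right (X : VF M) (f : Fn M) (Y : VF M) :
    S.nabla X (f • Y) = f • S.nabla X Y + X f • Y :=
  S.form_ext fun Z => by
    simp only [map_smul, map_add, LinearMap.add_apply, LinearMap.smul_apply, form_nabla,
      koszul_smul_middle, smul_eq_mul]

theorem nabla_neg_right (X Y : VF M) : S.nabla X (-Y) = -S.nabla X Y :=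
  S.form_ext fun Z => by
    rw [map_neg, LinearMap.neg_apply, form_nabla, form_nabla]
    apply Fn.two_mul_cancel
    rw [mul_neg, two_mul_koszul, two_mul_koszul]
    simp only [map_neg, LinearMap.neg_apply, VF.lie_neg', VF.neg_lie', Derivation.neg_apply]
    ring

theorem nabla_sub_right (X Y Y' : VF M) : S.nabla X (Y - Y') = S.nabla X Y - S.nabla X Y' := by
  rw [sub_eq_add_neg, nabla_add_right, nabla_neg_right, sub_eq_add_neg]

theorem nabla_neg_left (X Y : VF M) : S.nabla (-X) Y = -S.nabla X Y :=
  S.form_ext fun Z => by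
    rw [map_neg, LinearMap.neg_apply, form_nabla, form_nabla]
    apply Fn.two_mul_cancel
    rw [mul_neg, two_mul_koszul, two_mul_koszul]
    simp only [map_neg, LinearMap.neg_apply, VF.neg_lie', Derivation.neg_apply]
    ring

theorem nabla_conj (X Y : VF M) : S.nabla X.conj Y.conj = (S.nabla X Y).conj :=
  S.form_ext fun Z => by
    rw [← VF.conj_conj Z, g.real, form_nabla, form_nabla, koszul_conj]

/-- Metric compatibility of the Levi-Civita connection. -/
theorem nabla_metric (X Y Z : VF M) :
    X (g.toForm Y Z) = g.toForm (S.nabla X Y) Z + g.toForm Y (S.nabla X Z) := by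
  rw [g.symm Y (S.nabla X Z), form_nabla, form_nabla]
  apply Fn.two_mul_cancel
  rw [mul_add, two_mul_koszul, two_mul_koszul, g.symm Z Y, ← VF.lie_skew' Y Z, map_neg,
    LinearMap.neg_apply]
  ring

/-- The Levi-Civita connection is torsion-free. -/
theorem nabla_torsion (X Y : VF M) : ⁅X, Y⁆ = S.nabla X Y - S.nabla Y X :=
  S.form_ext fun Z => by
    rw [map_sub, LinearMap.sub_apply, form_nabla, form_nabla]
    apply Fn.two_mul_cancel
    rw [mul_sub, two_mul_koszul, two_mul_koszul, g.symm Y X, ← VF.lie_skew' X Y, map_neg,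
      LinearMap.neg_apply]
    ring

end SpinDyad

end Basic

end Debye

end

noncomputable section

namespace Debye

namespace SpinDyad

variable {M : Type*} [TopologicalSpace M] [ChartedSpace (EuclideanSpace ℝ (Fin 4)) M]
  {g : LorentzMetric M} (S : SpinDyad g)

/-! ### Connection forms of the dyad -/

/-- The coefficient of `ι` in `V^b ∇_b o`. -/
def aForm (V : VF M) : Fn M := -g.toForm S.m (S.nabla V S.l)
/-- The coefficient of `o` in `V^b ∇_b ι`. -/
def bForm (V : VF M) : Fn M := -g.toForm S.mb (S.nabla V S.n)
/-- The coefficient of `ō` in `V^b ∇_b ō`. -/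
def spinConnC (V : VF M) : Fn M := (S.spinConn V.conj).conj
/-- The coefficient of `ῑ` in `V^b ∇_b ō`. -/
def aFormC (V : VF M) : Fn M := -g.toForm S.mb (S.nabla V S.l)
/-- The coefficient of `ō` in `V^b ∇_b ῑ`. -/
def bFormC (V : VF M) : Fn M := -g.toForm S.m (S.nabla V S.n)

theorem two_mul_spinConn (V : VF M) : 2 * S.spinConn V =
    g.toForm S.n (S.nabla V S.l) + g.toForm S.m (S.nabla V S.mb) :=
  Fn.two_mul_half_smul _

theorem form_conj_nabla (X V Y : VF M) :
    (g.toForm X (S.nabla V.conj Y)).conj = g.toForm X.conj (S.nabla V Y.conj) := by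
  rw [← g.real, ← nabla_conj, VF.conj_conj]

theorem two_mul_spinConnC (V : VF M) : 2 * S.spinConnC V =
    g.toForm S.n (S.nabla V S.l) + g.toForm S.mb (S.nabla V S.m) := by
  have h : 2 * S.spinConnC V = (2 * S.spinConn V.conj).conj := by
    rw [Fn.conj_mul, Fn.conj_ofNat, spinConnC]
  rw [h, two_mul_spinConn, Fn.conj_add, form_conj_nabla, form_conj_nabla, conj_n, conj_l, conj_m,
    conj_mb]

theorem conj_spinConn (V : VF M) : (S.spinConn V).conj = S.spinConnC V.conj := by
  rw [spinConnC, VF.conj_conj]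

theorem conj_spinConnC (V : VF M) : (S.spinConnC V).conj = S.spinConn V.conj := by
  rw [spinConnC, Fn.conj_conj]

theorem conj_aForm (V : VF M) : (S.aForm V).conj = S.aFormC V.conj := by
  rw [aForm, aFormC, Fn.conj_neg, ← VF.conj_conj V, form_conj_nabla, VF.conj_conj, conj_m, conj_l]

theorem conj_bForm (V : VF M) : (S.bForm V).conj = S.bFormC V.conj := by
  rw [bForm, bFormC, Fn.conj_neg, ← VF.conj_conj V, form_conj_nabla, VF.conj_conj, conj_mb, conj_n]

theorem spinConn_add (V W : VF M) : S.spinConn (V + W) = S.spinConn V + S.spinConn W := by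
  simp only [spinConn, nabla_add_left, map_add, ← smul_add]
  congr 1
  ring

theorem spinConn_smul (f : Fn M) (V : VF M) : S.spinConn (f • V) = f * S.spinConn V := by
  simp only [spinConn, nabla_smul_left, map_smul, smul_eq_mul, mul_smul_comm, ← mul_add]

theorem spinConnC_add (V W : VF M) : S.spinConnC (V + W) = S.spinConnC V + S.spinConnC W := by
  simp only [spinConnC, VF.conj_add, spinConn_add, Fn.conj_add]

theorem spinConnC_smul (f : Fn M) (V : VF M) : S.spinConnC (f • V) = f * S.spinConnC V := by
  simp only [spinConnC, VF.conj_smul, spinConn_smul, Fn.conj_mul, Fn.conj_conj]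

theorem aForm_add (V W : VF M) : S.aForm (V + W) = S.aForm V + S.aForm W := by
  simp only [aForm, nabla_add_left, map_add]; ring

theorem aForm_smul (f : Fn M) (V : VF M) : S.aForm (f • V) = f * S.aForm V := by
  simp only [aForm, nabla_smul_left, map_smul, smul_eq_mul, mul_neg]

theorem bForm_add (V W : VF M) : S.bForm (V + W) = S.bForm V + S.bForm W := by
  simp only [bForm, nabla_add_left, map_add]; ring

theorem bForm_smul (f : Fn M) (V : VF M) : S.bForm (f • V) = f * S.bForm V := by
  simp only [bForm, nabla_smul_left, map_smul, smul_eq_mul, mul_neg]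

theorem aFormC_add (V W : VF M) : S.aFormC (V + W) = S.aFormC V + S.aFormC W := by
  simp only [aFormC, nabla_add_left, map_add]; ring

theorem aFormC_smul (f : Fn M) (V : VF M) : S.aFormC (f • V) = f * S.aFormC V := by
  simp only [aFormC, nabla_smul_left, map_smul, smul_eq_mul, mul_neg]

theorem bFormC_add (V W : VF M) : S.bFormC (V + W) = S.bFormC V + S.bFormC W := by
  simp only [bFormC, nabla_add_left, map_add]; ring

theorem bFormC_smul (f : Fn M) (V : VF M) : S.bFormC (f • V) = f * S.bFormC V := by
  simp only [bFormC, nabla_smul_left, map_smul, smul_eq_mul, mul_neg]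

theorem form_nabla_add_eq_zero (V X Y : VF M) (k : ℤ) (h : g.toForm X Y = (k : Fn M)) :
    g.toForm X (S.nabla V Y) + g.toForm Y (S.nabla V X) = 0 := by
  have := S.nabla_metric V X Y
  rw [h, V.map_intCast, g.symm _ Y] at this
  rw [this, add_comm]

theorem form_nabla_self (V X : VF M) (h : g.toForm X X = 0) : g.toForm X (S.nabla V X) = 0 := by
  have := S.form_nabla_add_eq_zero V X X 0 (by simpa using h)
  apply Fn.two_mul_cancel
  rw [two_mul, this, mul_zero]

theorem nabla_l (V : VF M) : S.nabla V S.l =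
    (S.spinConn V + S.spinConnC V) • S.l + S.aForm V • S.mb + S.aFormC V • S.m := by
  have h : S.spinConn V + S.spinConnC V = g.toForm S.n (S.nabla V S.l) := by
    apply Fn.two_mul_cancel
    have := S.form_nabla_add_eq_zero V S.m S.mb (-1) (by simp [form_mmb])
    linear_combination two_mul_spinConn S V + two_mul_spinConnC S V + this
  conv_lhs => rw [S.frame_expansion (S.nabla V S.l), S.form_nabla_self V S.l S.form_ll]
  rw [h, aForm, aFormC, VF.neg_fn_smul, VF.neg_fn_smul, zero_smul]
  abel

theorem nabla_n (V : VF M) : S.nabla V S.n =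
    S.bForm V • S.m + S.bFormC V • S.mb - (S.spinConn V + S.spinConnC V) • S.n := by
  have h : S.spinConn V + S.spinConnC V = -g.toForm S.l (S.nabla V S.n) := by
    apply Fn.two_mul_cancel
    have h1 := S.form_nabla_add_eq_zero V S.m S.mb (-1) (by simp [form_mmb])
    have h2 := S.form_nabla_add_eq_zero V S.l S.n 1 (by simp [form_ln])
    linear_combination two_mul_spinConn S V + two_mul_spinConnC S V + h1 + 2 * h2
  conv_lhs => rw [S.frame_expansion (S.nabla V S.n), S.form_nabla_self V S.n S.form_nn]
  rw [h, bForm, bFormC, VF.neg_fn_smul, VF.neg_fn_smul, VF.neg_fn_smul, zero_smul]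
  abel

theorem nabla_m (V : VF M) : S.nabla V S.m =
    (S.spinConn V - S.spinConnC V) • S.m + S.aForm V • S.n + S.bFormC V • S.l := by
  have h : S.spinConn V - S.spinConnC V = -g.toForm S.mb (S.nabla V S.m) := by
    apply Fn.two_mul_cancel
    have h1 := S.form_nabla_add_eq_zero V S.m S.mb (-1) (by simp [form_mmb])
    linear_combination two_mul_spinConn S V - two_mul_spinConnC S V + h1
  have h1 := S.form_nabla_add_eq_zero V S.l S.m 0 (by simp [form_lm])
  have h2 := S.form_nabla_add_eq_zero V S.n S.m 0 (by simp [form_nm])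
  conv_lhs => rw [S.frame_expansion (S.nabla V S.m), S.form_nabla_self V S.m S.form_mm,
    eq_neg_of_add_eq_zero_left h1, eq_neg_of_add_eq_zero_left h2]
  rw [h, aForm, bFormC]
  simp only [VF.neg_fn_smul, zero_smul]
  abel

theorem nabla_mb (V : VF M) : S.nabla V S.mb =
    (S.spinConnC V - S.spinConn V) • S.mb + S.bForm V • S.l + S.aFormC V • S.n := by
  have h : S.spinConnC V - S.spinConn V = -g.toForm S.m (S.nabla V S.mb) := by
    apply Fn.two_mul_cancel
    have h1 := S.form_nabla_add_eq_zero V S.m S.mb (-1) (by simp [form_mmb])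
    linear_combination two_mul_spinConnC S V - two_mul_spinConn S V + h1
  have h1 := S.form_nabla_add_eq_zero V S.l S.mb 0 (by simp [form_lmb])
  have h2 := S.form_nabla_add_eq_zero V S.n S.mb 0 (by simp [form_nmb])
  conv_lhs => rw [S.frame_expansion (S.nabla V S.mb), S.form_nabla_self V S.mb S.form_mbmb,
    eq_neg_of_add_eq_zero_left h1, eq_neg_of_add_eq_zero_left h2]
  rw [h, bForm, aFormC]
  simp only [VF.neg_fn_smul, zero_smul]
  abel

/-! ### Curvature of the spin connection -/

/-- The exterior derivative of a one-form. -/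
def extD (θ : VF M → Fn M) (X Y : VF M) : Fn M := X (θ Y) - Y (θ X) - θ ⁅X, Y⁆

/-- The coefficient of `o` in `R(X, Y) o`. -/
def curvW (X Y : VF M) : Fn M :=
  extD S.spinConn X Y + S.aForm Y * S.bForm X - S.aForm X * S.bForm Y

/-- The coefficient of `ι` in `R(X, Y) o`. -/
def curvA (X Y : VF M) : Fn M :=
  extD S.aForm X Y + 2 * (S.spinConn Y * S.aForm X - S.spinConn X * S.aForm Y)

/-- The coefficient of `o` in `R(X, Y) ι`. -/
def curvB (X Y : VF M) : Fn M :=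
  extD S.bForm X Y - 2 * (S.spinConn Y * S.bForm X - S.spinConn X * S.bForm Y)

/-- The coefficient of `ō` in `R(X, Y) ō`. -/
def curvWC (X Y : VF M) : Fn M :=
  extD S.spinConnC X Y + S.aFormC Y * S.bFormC X - S.aFormC X * S.bFormC Y

theorem riemann_ln (X Y : VF M) : S.riemann X Y S.l S.n = S.curvW X Y + S.curvWC X Y := by
  simp only [riemann, nabla_l, nabla_m, nabla_mb, nabla_add_right, nabla_smul_right,
    map_add, map_sub, map_smul, LinearMap.add_apply, LinearMap.sub_apply, LinearMap.smul_apply,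
    smul_eq_mul, form_ln, form_nn, form_mn, form_mbn, curvW, curvWC, extD]
  ring

theorem riemann_lm (X Y : VF M) : S.riemann X Y S.l S.m = -S.curvA X Y := by
  simp only [riemann, nabla_l, nabla_m, nabla_mb, nabla_add_right, nabla_smul_right,
    map_add, map_sub, map_smul, LinearMap.add_apply, LinearMap.sub_apply, LinearMap.smul_apply,
    smul_eq_mul, form_lm, form_nm, form_mm, form_mbm, curvA, extD]
  ring

theorem riemann_mmb (X Y : VF M) : S.riemann X Y S.m S.mb = S.curvWC X Y - S.curvW X Y := by
  simp only [riemann, nabla_l, nabla_n, nabla_m, nabla_add_right, nabla_smul_right,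
    map_add, map_sub, map_smul, LinearMap.add_apply, LinearMap.sub_apply, LinearMap.smul_apply,
    smul_eq_mul, form_lmb, form_nmb, form_mmb, form_mbmb, curvW, curvWC, extD]
  ring

theorem riemann_mbn (X Y : VF M) : S.riemann X Y S.mb S.n = S.curvB X Y := by
  simp only [riemann, nabla_l, nabla_n, nabla_mb, nabla_add_right, nabla_smul_right,
    map_add, map_sub, map_smul, LinearMap.add_apply, LinearMap.sub_apply, LinearMap.smul_apply,
    smul_eq_mul, form_ln, form_nn, form_mn, form_mbn, curvB, extD]
  ring

/-! ### Symmetries of the Riemann tensor -/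

theorem riemann_antisymm_left (X Y Z W : VF M) : S.riemann X Y Z W = -S.riemann Y X Z W := by
  rw [riemann, riemann, ← VF.lie_skew' X Y, nabla_neg_left]
  simp only [map_sub, map_neg, LinearMap.sub_apply, LinearMap.neg_apply]
  ring

theorem riemann_antisymm_right (X Y Z W : VF M) : S.riemann X Y Z W = -S.riemann X Y W Z := by
  have h : ⁅X, Y⁆ (g.toForm Z W) = X (Y (g.toForm Z W)) - Y (X (g.toForm Z W)) :=
    Derivation.commutator_apply _
  simp only [S.nabla_metric, map_add] at h
  simp only [riemann, map_sub, LinearMap.sub_apply]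
  rw [g.symm (S.nabla X (S.nabla Y W)), g.symm (S.nabla Y (S.nabla X W)),
    g.symm (S.nabla ⁅X, Y⁆ W)]
  linear_combination -h

theorem riemann_first_bianchi (X Y Z W : VF M) :
    S.riemann X Y Z W + S.riemann Y Z X W + S.riemann Z X Y W = 0 := by
  have h : ⁅X, ⁅Y, Z⁆⁆ + ⁅Y, ⁅Z, X⁆⁆ + ⁅Z, ⁅X, Y⁆⁆ = 0 := lie_jacobi X Y Z
  rw [S.nabla_torsion X, S.nabla_torsion Y ⁅Z, X⁆, S.nabla_torsion Z ⁅X, Y⁆] at h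
  have h1 : S.nabla X ⁅Y, Z⁆ = S.nabla X (S.nabla Y Z) - S.nabla X (S.nabla Z Y) := by
    rw [S.nabla_torsion Y Z, nabla_sub_right]
  have h2 : S.nabla Y ⁅Z, X⁆ = S.nabla Y (S.nabla Z X) - S.nabla Y (S.nabla X Z) := by
    rw [S.nabla_torsion Z X, nabla_sub_right]
  have h3 : S.nabla Z ⁅X, Y⁆ = S.nabla Z (S.nabla X Y) - S.nabla Z (S.nabla Y X) := by
    rw [S.nabla_torsion X Y, nabla_sub_right]
  rw [h1, h2, h3] at h
  have h4 := congrArg (fun V => g.toForm V W) h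
  simp only [map_add, map_sub, map_zero, LinearMap.add_apply, LinearMap.sub_apply,
    LinearMap.zero_apply] at h4
  simp only [riemann, map_sub, LinearMap.sub_apply]
  linear_combination h4

theorem riemann_pair_symm (X Y Z W : VF M) : S.riemann X Y Z W = S.riemann Z W X Y := by
  apply Fn.two_mul_cancel
  have b1 := S.riemann_first_bianchi X Y Z W
  have b2 := S.riemann_first_bianchi Y Z W X
  have b3 := S.riemann_first_bianchi Z W X Y
  have b4 := S.riemann_first_bianchi W X Y Z
  linear_combination b1 - b4 + b2 - b3 + S.riemann_antisymm_right X Y W Z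
    + S.riemann_antisymm_right Y W X Z - S.riemann_antisymm_right Y Z W X
    - S.riemann_antisymm_right Z W Y X - S.riemann_antisymm_left W Y Z X
    + S.riemann_antisymm_right W X Z Y + S.riemann_antisymm_left X Z W Y
    - S.riemann_antisymm_right Z X W Y

end SpinDyad

end Debye

end

noncomputable section

namespace Debye

namespace SpinDyad

variable {M : Type*} [TopologicalSpace M] [ChartedSpace (EuclideanSpace ℝ (Fin 4)) M]
  {g : LorentzMetric M} (S : SpinDyad g)

/-! ### Frame components of the curvature of an Einstein spacetime -/

theorem e_zero_zero : S.e 0 0 = S.l := rfl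
theorem e_zero_one : S.e 0 1 = S.m := rfl
theorem e_one_zero : S.e 1 0 = S.mb := rfl
theorem e_one_one : S.e 1 1 = S.n := rfl

theorem riemann_self_left (X Z W : VF M) : S.riemann X X Z W = 0 := by
  apply Fn.two_mul_cancel
  linear_combination S.riemann_antisymm_left X X Z W

theorem riemann_self_right (X Y Z : VF M) : S.riemann X Y Z Z = 0 := by
  apply Fn.two_mul_cancel
  linear_combination S.riemann_antisymm_right X Y Z Z

theorem ricci_eq (X Y : VF M) : S.ricci X Y = S.riemann X S.l Y S.n + S.riemann X S.n Y S.l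
    - S.riemann X S.m Y S.mb - S.riemann X S.mb Y S.m :=
  sum_eps fun A A' B B' => S.riemann X (S.e A A') Y (S.e B B')

variable {S} {Λ : ℝ}

theorem IsEinstein.ricci_eq (hE : S.IsEinstein Λ) (X Y : VF M) :
    S.riemann X S.l Y S.n + S.riemann X S.n Y S.l - S.riemann X S.m Y S.mb
      - S.riemann X S.mb Y S.m = 6 * algebraMap ℝ (Fn M) Λ * g.toForm X Y := by
  rw [← SpinDyad.ricci_eq, hE X Y, Algebra.smul_def, map_mul, map_ofNat]

theorem IsEinstein.scalarCurv_eq (hE : S.IsEinstein Λ) :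
    S.scalarCurv = 24 * algebraMap ℝ (Fn M) Λ := by
  have h : S.scalarCurv = S.ricci S.l S.n + S.ricci S.n S.l - S.ricci S.m S.mb
      - S.ricci S.mb S.m := sum_eps fun A A' B B' => S.ricci (S.e A A') (S.e B B')
  simp only [h, hE _ _, form_ln, form_nl, form_mmb, form_mbm, Algebra.smul_def, map_mul, map_ofNat]
  ring

theorem IsEinstein.weyl_eq (hE : S.IsEinstein Λ) (X Y Z W : VF M) :
    S.weyl X Y Z W = S.riemann X Y Z W - 2 * algebraMap ℝ (Fn M) Λ *
      (g.toForm X Z * g.toForm Y W - g.toForm X W * g.toForm Y Z) := by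
  have h2 : (algebraMap ℝ (Fn M) (1 / 2)) * 2 = 1 := by
    rw [← map_ofNat (algebraMap ℝ (Fn M)) 2, ← map_mul]; norm_num
  have h6 : (algebraMap ℝ (Fn M) (1 / 6)) * 6 = 1 := by
    rw [← map_ofNat (algebraMap ℝ (Fn M)) 6, ← map_mul]; norm_num
  simp only [weyl, hE _ _, hE.scalarCurv_eq, Algebra.smul_def, map_mul, map_ofNat]
  generalize algebraMap ℝ (Fn M) (1 / 2) = c at *
  generalize algebraMap ℝ (Fn M) (1 / 6) = d at *
  linear_combination (-6 * algebraMap ℝ (Fn M) Λ *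
      (g.toForm X Z * g.toForm Y W - g.toForm X W * g.toForm Y Z)) * h2 +
      (4 * algebraMap ℝ (Fn M) Λ *
      (g.toForm X Z * g.toForm Y W - g.toForm X W * g.toForm Y Z)) * h6

/-- The curvature of the spin connection on the frame, for an Einstein spacetime with `Ψ₀ = Ψ₁ = 0`.
-/
structure FrameCurvature (S : SpinDyad g) (L P : Fn M) : Prop where
  const (V : VF M) : V L = 0
  A_lm : S.curvA S.l S.m = 0
  A_lmb : S.curvA S.l S.mb = 0
  A_ln : S.curvA S.l S.n = 0
  A_mmb : S.curvA S.m S.mb = 0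
  A_mn : S.curvA S.m S.n = 0
  A_mbn : S.curvA S.mb S.n = -(P + 2 * L)
  W_lm : S.curvW S.l S.m = 0
  W_lmb : S.curvW S.l S.mb = 0
  W_ln : S.curvW S.l S.n = P - L
  W_mmb : S.curvW S.m S.mb = L - P
  W_mn : S.curvW S.m S.n = 0
  B_lm : S.curvB S.l S.m = P + 2 * L
  B_lmb : S.curvB S.l S.mb = 0
  B_ln : S.curvB S.l S.n = S.curvW S.mb S.n
  B_mmb : S.curvB S.m S.mb = -S.curvW S.mb S.n
  B_mn : S.curvB S.m S.n = 0

theorem four_mul_Psi (S : SpinDyad g) (A B C D : Fin 2) : 4 * S.Psi ![A, B, C, D] =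
    S.weyl (S.e A 0) (S.e B 1) (S.e C 0) (S.e D 1)
    - S.weyl (S.e A 0) (S.e B 1) (S.e C 1) (S.e D 0)
    - S.weyl (S.e A 1) (S.e B 0) (S.e C 0) (S.e D 1)
    + S.weyl (S.e A 1) (S.e B 0) (S.e C 1) (S.e D 0) := by
  have h4 : (4 : Fn M) * algebraMap ℝ (Fn M) (1 / 4) = 1 := by
    rw [← map_ofNat (algebraMap ℝ (Fn M)) 4, ← map_mul]; norm_num
  rw [Psi, Algebra.smul_def, ← mul_assoc, h4, one_mul]
  simp [Fin.sum_univ_two, eps]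
  ring

theorem IsEinstein.Psi_zero (hE : S.IsEinstein Λ) :
    4 * S.Psi ![0, 0, 0, 0] = 4 * S.riemann S.l S.m S.l S.m := by
  have h := S.four_mul_Psi 0 0 0 0
  simp only [e_zero_zero, e_zero_one] at h
  rw [h]
  simp only [hE.weyl_eq, form_lm, form_ml, form_ll, form_mm]
  rw [S.riemann_antisymm_left S.m S.l, S.riemann_antisymm_left S.m S.l,
    S.riemann_antisymm_right S.l S.m S.m S.l]
  ring

theorem IsEinstein.Psi_one (hE : S.IsEinstein Λ) :
    4 * S.Psi ![0, 0, 0, 1] =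
      2 * (S.riemann S.l S.m S.l S.n - S.riemann S.l S.m S.m S.mb) := by
  have h := S.four_mul_Psi 0 0 0 1
  simp only [e_zero_zero, e_zero_one, e_one_zero, e_one_one] at h
  rw [h]
  simp only [hE.weyl_eq, form_lm, form_ml, form_ll, form_mm, form_ln, form_mn, form_lmb, form_mmb]
  rw [S.riemann_antisymm_left S.m S.l, S.riemann_antisymm_left S.m S.l]
  ring

theorem IsEinstein.Psi_two (hE : S.IsEinstein Λ) :
    4 * S.Psi2 = 4 * (S.riemann S.l S.m S.mb S.n - 2 * algebraMap ℝ (Fn M) Λ) := by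
  have h := S.four_mul_Psi 0 0 1 1
  simp only [e_zero_zero, e_zero_one, e_one_zero, e_one_one] at h
  rw [Psi2, h]
  simp only [hE.weyl_eq, form_ln, form_mn, form_lmb, form_mmb]
  rw [S.riemann_antisymm_left S.m S.l, S.riemann_antisymm_left S.m S.l,
    S.riemann_antisymm_right S.l S.m S.n S.mb]
  ring

theorem Fn.four_mul_cancel {f h : Fn M} (H : 4 * f = 4 * h) : f = h := by
  apply Fn.two_mul_cancel
  apply Fn.two_mul_cancel
  linear_combination H

theorem two_mul_curvW (X Y : VF M) :
    2 * S.curvW X Y = S.riemann X Y S.l S.n - S.riemann X Y S.m S.mb := by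
  rw [riemann_ln, riemann_mmb]; ring

theorem IsEinstein.frameCurvature (hE : S.IsEinstein Λ) (h0 : S.Psi ![0, 0, 0, 0] = 0)
    (h1 : S.Psi ![0, 0, 0, 1] = 0) : S.FrameCurvature (algebraMap ℝ (Fn M) Λ) S.Psi2 := by
  have p0 := Fn.four_mul_cancel hE.Psi_zero
  have p1 := hE.Psi_one
  have p2 := Fn.four_mul_cancel hE.Psi_two
  rw [h0] at p0
  rw [h1] at p1
  have ll := hE.ricci_eq S.l S.l
  have lm := hE.ricci_eq S.l S.m
  have lmb := hE.ricci_eq S.l S.mb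
  have mm := hE.ricci_eq S.m S.m
  have mbmb := hE.ricci_eq S.mb S.mb
  have nn := hE.ricci_eq S.n S.n
  have nm := hE.ricci_eq S.n S.m
  have nmb := hE.ricci_eq S.n S.mb
  have ln := hE.ricci_eq S.l S.n
  have mmb := hE.ricci_eq S.m S.mb
  have bi := S.riemann_first_bianchi S.l S.n S.m S.mb
  have canL : ∀ Z W, S.riemann S.n S.l Z W = -S.riemann S.l S.n Z W ∧
      S.riemann S.m S.l Z W = -S.riemann S.l S.m Z W ∧
      S.riemann S.mb S.l Z W = -S.riemann S.l S.mb Z W ∧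
      S.riemann S.mb S.m Z W = -S.riemann S.m S.mb Z W ∧
      S.riemann S.n S.mb Z W = -S.riemann S.mb S.n Z W ∧
      S.riemann S.n S.m Z W = -S.riemann S.m S.n Z W := fun Z W =>
    ⟨S.riemann_antisymm_left _ _ _ _, S.riemann_antisymm_left _ _ _ _,
      S.riemann_antisymm_left _ _ _ _, S.riemann_antisymm_left _ _ _ _,
      S.riemann_antisymm_left _ _ _ _, S.riemann_antisymm_left _ _ _ _⟩
  have canR : ∀ X Y, S.riemann X Y S.n S.l = -S.riemann X Y S.l S.n ∧
      S.riemann X Y S.m S.l = -S.riemann X Y S.l S.m ∧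
      S.riemann X Y S.mb S.l = -S.riemann X Y S.l S.mb ∧
      S.riemann X Y S.mb S.m = -S.riemann X Y S.m S.mb ∧
      S.riemann X Y S.n S.mb = -S.riemann X Y S.mb S.n ∧
      S.riemann X Y S.n S.m = -S.riemann X Y S.m S.n := fun X Y =>
    ⟨S.riemann_antisymm_right _ _ _ _, S.riemann_antisymm_right _ _ _ _,
      S.riemann_antisymm_right _ _ _ _, S.riemann_antisymm_right _ _ _ _,
      S.riemann_antisymm_right _ _ _ _, S.riemann_antisymm_right _ _ _ _⟩
  have sw := S.riemann_pair_symm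
  simp only [(canL _ _).1, (canL _ _).2.1, (canL _ _).2.2.1, (canL _ _).2.2.2.1,
    (canL _ _).2.2.2.2.1, (canL _ _).2.2.2.2.2, (canR _ _).1, (canR _ _).2.1,
    (canR _ _).2.2.1, (canR _ _).2.2.2.1, (canR _ _).2.2.2.2.1, (canR _ _).2.2.2.2.2, riemann_self_left,
    riemann_self_right, form_ll, form_lm, form_lmb, form_mm, form_mbmb, form_nn, form_nm,
    form_nmb, form_ln, form_mmb] at ll lm lmb mm mbmb nn nm nmb ln mmb bi
  have A (X Y : VF M) : S.curvA X Y = -S.riemann X Y S.l S.m := by rw [riemann_lm]; ring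
  have W (X Y : VF M) := S.two_mul_curvW X Y
  have B (X Y : VF M) : S.curvB X Y = S.riemann X Y S.mb S.n := by rw [riemann_mbn]
  refine ⟨fun V => V.map_algebraMap Λ, ?_, ?_, ?_, ?_, ?_, ?_, ?_, ?_, ?_, ?_, ?_, ?_, ?_, ?_, ?_, ?_⟩
  · rw [A]; linear_combination p0
  · apply Fn.two_mul_cancel
    rw [A]
    linear_combination ll + sw S.l S.m S.l S.mb
  · apply Fn.four_mul_cancel
    rw [A]
    linear_combination 2 * lm + p1 + 2 * sw S.l S.m S.l S.n
  · apply Fn.four_mul_cancel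
    rw [A]
    linear_combination 2 * lm - p1 - 2 * sw S.l S.m S.l S.n - 4 * sw S.m S.mb S.l S.m
  · apply Fn.two_mul_cancel
    rw [A]
    linear_combination mm + sw S.l S.m S.m S.n
  · rw [A]
    linear_combination p2 + sw S.l S.m S.mb S.n
  · apply Fn.four_mul_cancel
    linear_combination 2 * W S.l S.m - p1
  · apply Fn.two_mul_cancel
    linear_combination W S.l S.mb - lmb + sw S.l S.mb S.l S.n
  · apply Fn.two_mul_cancel
    linear_combination W S.l S.n - ln - bi - 2 * p2 + sw S.l S.mb S.m S.n
  · apply Fn.two_mul_cancel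
    linear_combination W S.m S.mb - mmb + bi + 2 * p2 + sw S.m S.mb S.l S.n
  · apply Fn.two_mul_cancel
    linear_combination W S.m S.n - nm + sw S.m S.n S.l S.n
  · rw [B]
    linear_combination -p2
  · apply Fn.two_mul_cancel
    rw [B]
    linear_combination -mbmb + sw S.l S.mb S.mb S.n
  · apply Fn.two_mul_cancel
    rw [B]
    linear_combination -W S.mb S.n - nmb + sw S.l S.n S.mb S.n
  · apply Fn.two_mul_cancel
    rw [B]
    linear_combination W S.mb S.n - nmb - sw S.l S.n S.mb S.n + 2 * sw S.m S.mb S.mb S.n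
  · apply Fn.two_mul_cancel
    rw [B]
    linear_combination -nn + sw S.m S.n S.mb S.n

end SpinDyad

end Debye

end

noncomputable section

namespace Debye

namespace SpinDyad

variable {M : Type*} [TopologicalSpace M] [ChartedSpace (EuclideanSpace ℝ (Fin 4)) M]
  {g : LorentzMetric M} (S : SpinDyad g)

/-! ### Commutators of the frame and the Bianchi identities -/

theorem lie_lm : ⁅S.l, S.m⁆ = (S.bFormC S.l - S.spinConn S.m - S.spinConnC S.m) • S.l
    + S.aForm S.l • S.n + (S.spinConn S.l - S.spinConnC S.l - S.aFormC S.m) • S.m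
    + (-S.aForm S.m) • S.mb := by
  rw [nabla_torsion, nabla_l, nabla_m]; module

theorem lie_lmb : ⁅S.l, S.mb⁆ = (S.bForm S.l - S.spinConn S.mb - S.spinConnC S.mb) • S.l
    + S.aFormC S.l • S.n + (-S.aFormC S.mb) • S.m
    + (S.spinConnC S.l - S.spinConn S.l - S.aForm S.mb) • S.mb := by
  rw [nabla_torsion, nabla_l, nabla_mb]; module

theorem lie_ln : ⁅S.l, S.n⁆ = (-(S.spinConn S.n + S.spinConnC S.n)) • S.l
    + (-(S.spinConn S.l + S.spinConnC S.l)) • S.n + (S.bForm S.l - S.aFormC S.n) • S.m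
    + (S.bFormC S.l - S.aForm S.n) • S.mb := by
  rw [nabla_torsion, nabla_l, nabla_n]; module

theorem lie_mmb : ⁅S.m, S.mb⁆ = (S.bForm S.m - S.bFormC S.mb) • S.l
    + (S.aFormC S.m - S.aForm S.mb) • S.n + (S.spinConnC S.mb - S.spinConn S.mb) • S.m
    + (S.spinConnC S.m - S.spinConn S.m) • S.mb := by
  rw [nabla_torsion, nabla_m, nabla_mb]; module

theorem lie_mn : ⁅S.m, S.n⁆ = (-S.bFormC S.n) • S.l
    + (-S.aForm S.n - S.spinConn S.m - S.spinConnC S.m) • S.n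
    + (S.bForm S.m - S.spinConn S.n + S.spinConnC S.n) • S.m + S.bFormC S.m • S.mb := by
  rw [nabla_torsion, nabla_m, nabla_n]; module

theorem lie_mbn : ⁅S.mb, S.n⁆ = (-S.bForm S.n) • S.l
    + (-S.aFormC S.n - S.spinConn S.mb - S.spinConnC S.mb) • S.n
    + S.bForm S.mb • S.m + (S.bFormC S.mb - S.spinConnC S.n + S.spinConn S.n) • S.mb := by
  rw [nabla_torsion, nabla_mb, nabla_n]; module

theorem aForm_neg (V : VF M) : S.aForm (-V) = -S.aForm V := by
  rw [aForm, aForm, nabla_neg_left, map_neg]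

theorem spinConn_neg (V : VF M) : S.spinConn (-V) = -S.spinConn V := by
  rw [spinConn, spinConn, nabla_neg_left, nabla_neg_left, map_neg, map_neg, ← smul_neg]
  congr 1
  ring

theorem jacobi_form {θ : VF M → Fn M} (hadd : ∀ X Y, θ (X + Y) = θ X + θ Y)
    (hneg : ∀ X, θ (-X) = -θ X) (X Y Z : VF M) :
    θ ⁅⁅X, Y⁆, Z⁆ - θ ⁅⁅X, Z⁆, Y⁆ + θ ⁅⁅Y, Z⁆, X⁆ = 0 := by
  have h : ⁅⁅X, Y⁆, Z⁆ = ⁅⁅X, Z⁆, Y⁆ + -⁅⁅Y, Z⁆, X⁆ := by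
    ext1 f
    simp only [Derivation.commutator_apply, Derivation.add_apply, Derivation.neg_apply, map_sub]
    ring
  rw [h, hadd, hneg]
  ring

theorem curvA_bianchi (X Y Z : VF M) :
    X (S.curvA Y Z) - Y (S.curvA X Z) + Z (S.curvA X Y)
      - S.curvA ⁅X, Y⁆ Z + S.curvA ⁅X, Z⁆ Y - S.curvA ⁅Y, Z⁆ X
    = 2 * (S.spinConn X * S.curvA Y Z - S.spinConn Y * S.curvA X Z + S.spinConn Z * S.curvA X Y)
      - 2 * (S.aForm X * S.curvW Y Z - S.aForm Y * S.curvW X Z + S.aForm Z * S.curvW X Y) := by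
  have h := jacobi_form S.aForm_add S.aForm_neg X Y Z
  simp only [curvA, curvW, extD, map_add, map_sub, VF.apply_mul, VF.apply_ofNat,
    Derivation.commutator_apply]
  linear_combination h

theorem curvW_bianchi (X Y Z : VF M) :
    X (S.curvW Y Z) - Y (S.curvW X Z) + Z (S.curvW X Y)
      - S.curvW ⁅X, Y⁆ Z + S.curvW ⁅X, Z⁆ Y - S.curvW ⁅Y, Z⁆ X
    = (S.aForm X * S.curvB Y Z - S.aForm Y * S.curvB X Z + S.aForm Z * S.curvB X Y)
      - (S.bForm X * S.curvA Y Z - S.bForm Y * S.curvA X Z + S.bForm Z * S.curvA X Y) := by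
  have h := jacobi_form S.spinConn_add S.spinConn_neg X Y Z
  simp only [curvA, curvW, curvB, extD, map_add, map_sub, VF.apply_mul,
    Derivation.commutator_apply]
  linear_combination h

theorem curvA_add_left (X X' Y : VF M) : S.curvA (X + X') Y = S.curvA X Y + S.curvA X' Y := by
  simp only [curvA, extD, aForm_add, spinConn_add, Derivation.add_apply, map_add, VF.add_lie']
  ring

theorem curvA_smul_left (f : Fn M) (X Y : VF M) : S.curvA (f • X) Y = f * S.curvA X Y := by
  simp only [curvA, extD, aForm_smul, spinConn_smul, Derivation.smul_apply, VF.apply_mul,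
    VF.fn_smul_lie, smul_eq_mul, sub_eq_add_neg (f • ⁅X, Y⁆), aForm_add, aForm_neg]
  ring

theorem curvW_add_left (X X' Y : VF M) : S.curvW (X + X') Y = S.curvW X Y + S.curvW X' Y := by
  simp only [curvW, extD, aForm_add, bForm_add, spinConn_add, Derivation.add_apply, map_add,
    VF.add_lie']
  ring

theorem curvW_smul_left (f : Fn M) (X Y : VF M) : S.curvW (f • X) Y = f * S.curvW X Y := by
  simp only [curvW, extD, aForm_smul, bForm_smul, spinConn_smul, Derivation.smul_apply,
    VF.apply_mul, VF.fn_smul_lie, smul_eq_mul, sub_eq_add_neg (f • ⁅X, Y⁆), spinConn_add,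
    spinConn_neg]
  ring

theorem curvA_antisymm (X Y : VF M) : S.curvA X Y = -S.curvA Y X := by
  rw [curvA, curvA, extD, extD, ← VF.lie_skew' X Y, aForm_neg]; ring

theorem curvW_antisymm (X Y : VF M) : S.curvW X Y = -S.curvW Y X := by
  rw [curvW, curvW, extD, extD, ← VF.lie_skew' X Y, spinConn_neg]; ring

theorem curvA_self (X : VF M) : S.curvA X X = 0 := by
  apply Fn.two_mul_cancel
  linear_combination S.curvA_antisymm X X

theorem curvW_self (X : VF M) : S.curvW X X = 0 := by
  apply Fn.two_mul_cancel
  linear_combination S.curvW_antisymm X X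

variable {S} {L P : Fn M}

theorem Fn.eq_zero_of_three_mul (hP : ∀ x, P x ≠ 0) {f : Fn M} (h : 3 * (P * f) = 0) : f = 0 := by
  have h3 : (algebraMap ℝ (Fn M) (1 / 3)) * 3 = 1 := by
    rw [← map_ofNat (algebraMap ℝ (Fn M)) 3, ← map_mul]; norm_num
  have h1 : P * f = 0 := by
    linear_combination algebraMap ℝ (Fn M) (1 / 3) * h - (P * f) * h3
  ext x
  have hx : P x * f x = 0 := congrArg (fun F : Fn M => F x) h1
  exact (mul_eq_zero.1 hx).resolve_left (hP x)

/-- The congruence of `o` is geodesic. -/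
theorem FrameCurvature.aForm_l (h : S.FrameCurvature L P) (hP : ∀ x, P x ≠ 0) :
    S.aForm S.l = 0 := by
  have hb := S.curvA_bianchi S.l S.m S.mb
  simp only [lie_lm, lie_lmb, lie_mmb, curvA_add_left, curvA_smul_left, curvA_self,
    S.curvA_antisymm S.n, S.curvA_antisymm S.m S.l, S.curvA_antisymm S.mb S.l,
    S.curvA_antisymm S.mb S.m, h.A_lm, h.A_lmb,
    h.A_ln, h.A_mmb, h.A_mn, h.A_mbn, h.W_lm, h.W_lmb, h.W_mmb, map_zero] at hb
  exact Fn.eq_zero_of_three_mul hP (by linear_combination -hb)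

/-- The congruence of `o` is shear-free. -/
theorem FrameCurvature.aForm_m (h : S.FrameCurvature L P) (hP : ∀ x, P x ≠ 0) :
    S.aForm S.m = 0 := by
  have hb := S.curvA_bianchi S.l S.m S.n
  simp only [lie_lm, lie_ln, lie_mn, curvA_add_left, curvA_smul_left, curvA_self,
    S.curvA_antisymm S.n, S.curvA_antisymm S.m S.l, S.curvA_antisymm S.mb S.l,
    S.curvA_antisymm S.mb S.m, h.A_lm, h.A_lmb,
    h.A_ln, h.A_mmb, h.A_mn, h.A_mbn, h.W_lm, h.W_ln, h.W_mn, map_zero] at hb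
  exact Fn.eq_zero_of_three_mul hP (by linear_combination -hb)

theorem FrameCurvature.l_Psi2 (h : S.FrameCurvature L P) (hl : S.aForm S.l = 0)
    (hm : S.aForm S.m = 0) : S.l P = -3 * S.aForm S.mb * P := by
  have hc : S.aFormC S.l = 0 := by rw [← S.conj_l, ← conj_aForm, hl, Fn.conj_zero]
  have hcb : S.aFormC S.mb = 0 := by rw [← S.conj_m, ← conj_aForm, hm, Fn.conj_zero]
  have hb := S.curvW_bianchi S.l S.m S.mb
  simp only [lie_lm, lie_lmb, lie_mmb, curvW_add_left, curvW_smul_left, curvW_self,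
    S.curvW_antisymm S.n, S.curvW_antisymm S.m S.l, S.curvW_antisymm S.mb S.l,
    S.curvW_antisymm S.mb S.m, h.A_lm, h.A_lmb, h.A_mmb, h.W_lm, h.W_lmb, h.W_ln, h.W_mn,
    h.W_mmb, h.B_lm, h.B_lmb, map_zero, map_sub, h.const, hl, hm, hc, hcb] at hb
  linear_combination -hb

theorem FrameCurvature.m_Psi2 (h : S.FrameCurvature L P) (hl : S.aForm S.l = 0)
    (hm : S.aForm S.m = 0) : S.m P = -3 * S.aForm S.n * P := by
  have hb := S.curvW_bianchi S.l S.m S.n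
  simp only [lie_lm, lie_ln, lie_mn, curvW_add_left, curvW_smul_left, curvW_self,
    S.curvW_antisymm S.n, S.curvW_antisymm S.m S.l, S.curvW_antisymm S.mb S.l,
    S.curvW_antisymm S.mb S.m, h.A_lm, h.A_ln, h.A_mn, h.W_lm, h.W_lmb, h.W_ln, h.W_mn,
    h.W_mmb, h.B_lm, h.B_mn, map_zero, map_sub, h.const, hl, hm] at hb
  linear_combination -hb

end SpinDyad

end Debye

end

noncomputable section

namespace Debye

namespace SpinDyad

variable {M : Type*} [TopologicalSpace M] [ChartedSpace (EuclideanSpace ℝ (Fin 4)) M]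
  {g : LorentzMetric M} (S : SpinDyad g)

/-! ### The GHP equations of a type II Einstein spacetime -/

/-- `κ' = m̄^a n^b ∇_b n_a` -/
def kappa' : Fn M := g.toForm S.mb (S.nabla S.n S.n)

theorem aForm_mb : S.aForm S.mb = -S.rho := rfl
theorem aForm_n : S.aForm S.n = -S.tau := rfl
theorem bForm_l : S.bForm S.l = -S.tau' := rfl
theorem bForm_n : S.bForm S.n = -S.kappa' := rfl
theorem bForm_m : S.bForm S.m = -S.rho' := rfl
theorem bForm_mb : S.bForm S.mb = -S.sigma' := rfl

theorem aFormC_m : S.aFormC S.m = -S.rho.conj := by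
  rw [← S.conj_mb, ← conj_aForm, aForm_mb, Fn.conj_neg]
theorem aFormC_n : S.aFormC S.n = -S.tau.conj := by
  rw [← S.conj_n, ← conj_aForm, aForm_n, Fn.conj_neg]
theorem bFormC_l : S.bFormC S.l = -S.tau'.conj := by
  rw [← S.conj_l, ← conj_bForm, bForm_l, Fn.conj_neg]
theorem bFormC_n : S.bFormC S.n = -S.kappa'.conj := by
  rw [← S.conj_n, ← conj_bForm, bForm_n, Fn.conj_neg]
theorem bFormC_m : S.bFormC S.m = -S.sigma'.conj := by
  rw [← S.conj_mb, ← conj_bForm, bForm_mb, Fn.conj_neg]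
theorem bFormC_mb : S.bFormC S.mb = -S.rho'.conj := by
  rw [← S.conj_m, ← conj_bForm, bForm_m, Fn.conj_neg]

theorem curvWC_conj (X Y : VF M) : S.curvWC X.conj Y.conj = (S.curvW X Y).conj := by
  simp only [curvWC, curvW, extD, Fn.conj_add, Fn.conj_sub, Fn.conj_mul, conj_spinConn,
    conj_aForm, conj_bForm, VF.conj_lie, VF.conj_apply, conj_spinConnC, VF.conj_conj]

theorem ghp_eq (V : VF M) (p q : ℤ) (η : Fn M) : S.ghp V p q η =
    V η - (p : Fn M) * S.spinConn V * η - (q : Fn M) * S.spinConnC V * η := rfl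

theorem Fn.conj_intCast (k : ℤ) : (k : Fn M).conj = k := by
  have h : (k : Fn M) = algebraMap ℝ (Fn M) k := (map_intCast _ _).symm
  rw [h, Fn.conj_algebraMap]

theorem ghp_conj (V : VF M) (p q : ℤ) (η : Fn M) :
    (S.ghp V p q η).conj = S.ghp V.conj q p η.conj := by
  simp only [ghp_eq, Fn.conj_sub, Fn.conj_mul, Fn.conj_intCast, conj_spinConn, conj_spinConnC,
    VF.conj_apply, Fn.conj_conj]
  ring

/-- The vanishing of `κ` and `σ`, the Ricci equations, the Bianchi identities for `Ψ₂` and the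
commutators of the GHP formalism that enter the Debye problem; `P` is `Ψ₂`, `N` is `Ψ₃` and `L` is
`Λ`. -/
structure GHPEquations (L P N : Fn M) : Prop where
  kappa : S.aForm S.l = 0
  sigma : S.aForm S.m = 0
  const (V : VF M) : V L = 0
  conj_L : L.conj = L
  l_Psi : S.l P = 3 * S.rho * P
  m_Psi : S.m P = 3 * S.tau * P
  tho_rho : S.ghp S.l 1 1 S.rho = S.rho * S.rho
  tho_tau : S.ghp S.l 1 (-1) S.tau = S.rho * (S.tau - S.tau'.conj)
  edt_rho : S.ghp S.m 1 1 S.rho = (S.rho - S.rho.conj) * S.tau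
  edt_tau : S.ghp S.m 1 (-1) S.tau = S.tau * S.tau - S.rho * S.sigma'.conj
  tho'_rho : S.ghp S.n 1 1 S.rho - S.ghp S.mb 1 (-1) S.tau =
    S.rho * S.rho'.conj - S.tau * S.tau.conj - P - 2 * L
  tho_rho' : S.ghp S.l (-1) (-1) S.rho' - S.ghp S.m (-1) 1 S.tau' =
    S.rho' * S.rho.conj - S.tau' * S.tau'.conj - P - 2 * L
  tho_sigma' : S.ghp S.l (-3) 1 S.sigma' - S.ghp S.mb (-1) 1 S.tau' =
    S.rho * S.sigma' - S.tau' * S.tau'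
  edt'_rho' : S.ghp S.mb (-1) (-1) S.rho' - S.ghp S.m (-3) 1 S.sigma' =
    (S.rho' - S.rho'.conj) * S.tau' + (S.rho.conj - S.rho) * S.kappa' - N
  tho'_tau' : S.ghp S.n (-1) 1 S.tau' - S.ghp S.l (-3) (-1) S.kappa' =
    S.rho' * (S.tau' - S.tau.conj) + S.sigma' * (S.tau'.conj - S.tau) + N
  comm_lm (p q : ℤ) (η : Fn M) :
    S.ghp S.l (p + 1) (q - 1) (S.ghp S.m p q η) - S.ghp S.m (p + 1) (q + 1) (S.ghp S.l p q η) =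
      S.rho.conj * S.ghp S.m p q η - S.tau'.conj * S.ghp S.l p q η
        + q * S.rho.conj * S.tau'.conj * η
  comm_lmb (p q : ℤ) (η : Fn M) :
    S.ghp S.l (p - 1) (q + 1) (S.ghp S.mb p q η) - S.ghp S.mb (p + 1) (q + 1) (S.ghp S.l p q η) =
      S.rho * S.ghp S.mb p q η - S.tau' * S.ghp S.l p q η + p * S.rho * S.tau' * η
  comm_ln (p q : ℤ) (η : Fn M) :
    S.ghp S.l (p - 1) (q - 1) (S.ghp S.n p q η) - S.ghp S.n (p + 1) (q + 1) (S.ghp S.l p q η) =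
      (S.tau.conj - S.tau') * S.ghp S.m p q η + (S.tau - S.tau'.conj) * S.ghp S.mb p q η
        - p * (P - S.tau * S.tau' - L) * η - q * (P.conj - S.tau.conj * S.tau'.conj - L) * η
  comm_mmb (p q : ℤ) (η : Fn M) :
    S.ghp S.m (p - 1) (q + 1) (S.ghp S.mb p q η) - S.ghp S.mb (p + 1) (q - 1) (S.ghp S.m p q η) =
      (S.rho'.conj - S.rho') * S.ghp S.l p q η + (S.rho - S.rho.conj) * S.ghp S.n p q η
        + p * (S.rho * S.rho' + P - L) * η - q * (S.rho.conj * S.rho'.conj + P.conj - L) * η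
  comm_nm (p q : ℤ) (η : Fn M) :
    S.ghp S.n (p + 1) (q - 1) (S.ghp S.m p q η) - S.ghp S.m (p - 1) (q - 1) (S.ghp S.n p q η) =
      S.rho' * S.ghp S.m p q η + S.sigma'.conj * S.ghp S.mb p q η - S.tau * S.ghp S.n p q η
        - S.kappa'.conj * S.ghp S.l p q η
        + q * (S.rho.conj * S.kappa'.conj - S.tau.conj * S.sigma'.conj + N.conj) * η
        - p * S.rho' * S.tau * η

variable {S} {L P : Fn M}

theorem FrameCurvature.ghpEquations (h : S.FrameCurvature L P) (hP : ∀ x, P x ≠ 0)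
    (hL : L.conj = L) : S.GHPEquations L P (S.curvW S.mb S.n) := by
  have hl := h.aForm_l hP
  have hm := h.aForm_m hP
  have hlc : S.aFormC S.l = 0 := by rw [← S.conj_l, ← conj_aForm, hl, Fn.conj_zero]
  have hmc : S.aFormC S.mb = 0 := by rw [← S.conj_m, ← conj_aForm, hm, Fn.conj_zero]
  have C_lm : S.curvWC S.l S.m = 0 := by
    have := S.curvWC_conj S.l S.mb
    rwa [h.W_lmb, Fn.conj_zero, S.conj_l, S.conj_mb] at this
  have C_lmb : S.curvWC S.l S.mb = 0 := by
    have := S.curvWC_conj S.l S.m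
    rwa [h.W_lm, Fn.conj_zero, S.conj_l, S.conj_m] at this
  have C_ln : S.curvWC S.l S.n = P.conj - L := by
    have := S.curvWC_conj S.l S.n
    rwa [h.W_ln, Fn.conj_sub, hL, S.conj_l, S.conj_n] at this
  have C_mmb : S.curvWC S.m S.mb = P.conj - L := by
    have := S.curvWC_conj S.mb S.m
    rwa [S.curvW_antisymm, h.W_mmb, Fn.conj_neg, Fn.conj_sub, hL, S.conj_m, S.conj_mb,
      neg_sub] at this
  have C_mn : S.curvWC S.m S.n = (S.curvW S.mb S.n).conj := by
    have := S.curvWC_conj S.mb S.n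
    rwa [S.conj_mb, S.conj_n] at this
  have lPsi := h.l_Psi2 hl hm
  have mPsi := h.m_Psi2 hl hm
  obtain ⟨hc, -, A_lmb, A_ln, A_mmb, A_mn, A_mbn, W_lm, W_lmb, W_ln, W_mmb, W_mn, B_lm, B_lmb,
    B_ln, B_mmb, -⟩ := h
  generalize S.curvW S.mb S.n = N at *
  simp only [curvA, curvB, extD, lie_lm, lie_lmb, lie_ln, lie_mmb, lie_mn, lie_mbn,
    aForm_add, aForm_smul, bForm_add, bForm_smul, hl, hm, hlc, hmc, map_zero, aForm_mb, aForm_n,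
    bForm_l, bForm_n, bForm_m, bForm_mb, aFormC_m, aFormC_n, bFormC_l, bFormC_n, bFormC_m,
    bFormC_mb, map_neg] at A_lmb A_ln A_mmb A_mn A_mbn B_lm B_lmb B_ln B_mmb lPsi mPsi
  simp only [curvW, curvWC, extD, lie_lm, lie_lmb, lie_ln, lie_mmb, lie_mn,
    spinConn_add, spinConn_smul, spinConnC_add, spinConnC_smul, hl, hm, hlc, hmc, aForm_mb, aForm_n,
    bForm_l, bForm_n, bForm_m, bForm_mb, aFormC_m, aFormC_n, bFormC_l, bFormC_n, bFormC_m,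
    bFormC_mb] at W_lm W_lmb W_ln W_mmb W_mn C_lm C_lmb C_ln C_mmb C_mn
  have lie (X Y : VF M) (η : Fn M) : X (Y η) = Y (X η) + ⁅X, Y⁆ η := by
    rw [Derivation.commutator_apply]; ring
  refine ⟨hl, hm, hc, hL, ?_, ?_, ?_, ?_, ?_, ?_, ?_, ?_, ?_, ?_, ?_, fun p q η => ?_,
    fun p q η => ?_, fun p q η => ?_, fun p q η => ?_, fun p q η => ?_⟩
  · linear_combination lPsi
  · linear_combination mPsi
  · simp only [ghp_eq]; push_cast
    linear_combination -A_lmb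
  · simp only [ghp_eq]; push_cast
    linear_combination -A_ln
  · simp only [ghp_eq]; push_cast
    linear_combination -A_mmb
  · simp only [ghp_eq]; push_cast
    linear_combination -A_mn
  · simp only [ghp_eq]; push_cast
    linear_combination A_mbn
  · simp only [ghp_eq]; push_cast
    linear_combination -B_lm
  · simp only [ghp_eq]; push_cast
    linear_combination -B_lmb
  · simp only [ghp_eq]; push_cast
    linear_combination B_mmb
  · simp only [ghp_eq]; push_cast
    linear_combination B_ln
  all_goals
    simp only [ghp_eq, map_sub, VF.apply_mul, Derivation.map_intCast]
    push_cast
  · have hη := lie S.l S.m η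
    simp only [lie_lm, Derivation.add_apply, Derivation.smul_apply, smul_eq_mul, hl, hm,
      aFormC_m, bFormC_l] at hη
    linear_combination hη - p * η * W_lm - q * η * C_lm
  · have hη := lie S.l S.mb η
    simp only [lie_lmb, Derivation.add_apply, Derivation.smul_apply, smul_eq_mul, hlc, hmc,
      aForm_mb, bForm_l] at hη
    linear_combination hη - p * η * W_lmb - q * η * C_lmb
  · have hη := lie S.l S.n η
    simp only [lie_ln, Derivation.add_apply, Derivation.smul_apply, smul_eq_mul, aForm_n,
      aFormC_n, bForm_l, bFormC_l] at hη
    linear_combination hη - p * η * W_ln - q * η * C_ln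
  · have hη := lie S.m S.mb η
    simp only [lie_mmb, Derivation.add_apply, Derivation.smul_apply, smul_eq_mul, aForm_mb,
      aFormC_m, bForm_m, bFormC_mb] at hη
    linear_combination hη - p * η * W_mmb - q * η * C_mmb
  · have hη := lie S.m S.n η
    simp only [lie_mn, Derivation.add_apply, Derivation.smul_apply, smul_eq_mul, aForm_n,
      bFormC_n, bForm_m, bFormC_m] at hη
    linear_combination -hη + p * η * W_mn + q * η * C_mn

end SpinDyad

end Debye

end

noncomputable section

namespace Debye

namespace SpinDyad

variable {M : Type*} [TopologicalSpace M] [ChartedSpace (EuclideanSpace ℝ (Fin 4)) M]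
  {g : LorentzMetric M} (S : SpinDyad g)

/-! ### GHP calculus -/

theorem ghp_add (V : VF M) (p q : ℤ) (x y : Fn M) :
    S.ghp V p q (x + y) = S.ghp V p q x + S.ghp V p q y := by
  simp only [ghp_eq, map_add]; ring

theorem ghp_sub (V : VF M) (p q : ℤ) (x y : Fn M) :
    S.ghp V p q (x - y) = S.ghp V p q x - S.ghp V p q y := by
  simp only [ghp_eq, map_sub]; ring

theorem ghp_neg (V : VF M) (p q : ℤ) (x : Fn M) : S.ghp V p q (-x) = -S.ghp V p q x := by
  simp only [ghp_eq, map_neg]; ring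

theorem ghp_mul (V : VF M) (p q r s : ℤ) (x y : Fn M) :
    S.ghp V p q (x * y) = S.ghp V r s x * y + x * S.ghp V (p - r) (q - s) y := by
  simp only [ghp_eq, VF.apply_mul]; push_cast; ring

theorem ghp_ofNat_mul (V : VF M) (p q : ℤ) (k : ℕ) [k.AtLeastTwo] (x : Fn M) :
    S.ghp V p q (ofNat(k) * x) = ofNat(k) * S.ghp V p q x := by
  simp only [ghp_eq, VF.apply_ofNat_mul]; ring

theorem ghp_rho_mul (V : VF M) (p q : ℤ) (x : Fn M) : S.ghp V p q (S.rho * x) =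
    S.ghp V 1 1 S.rho * x + S.rho * S.ghp V (p - 1) (q - 1) x := S.ghp_mul V p q 1 1 _ _

theorem ghp_tau_mul (V : VF M) (p q : ℤ) (x : Fn M) : S.ghp V p q (S.tau * x) =
    S.ghp V 1 (-1) S.tau * x + S.tau * S.ghp V (p - 1) (q - -1) x := S.ghp_mul V p q 1 (-1) _ _

theorem ghp_conj_rho_mul (V : VF M) (p q : ℤ) (x : Fn M) : S.ghp V p q (S.rho.conj * x) =
    S.ghp V 1 1 S.rho.conj * x + S.rho.conj * S.ghp V (p - 1) (q - 1) x :=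
  S.ghp_mul V p q 1 1 _ _

theorem ghp_conj_tau_mul (V : VF M) (p q : ℤ) (x : Fn M) : S.ghp V p q (S.tau.conj * x) =
    S.ghp V (-1) 1 S.tau.conj * x + S.tau.conj * S.ghp V (p - -1) (q - 1) x :=
  S.ghp_mul V p q (-1) 1 _ _

theorem ghp_conj_rho'_mul (V : VF M) (p q : ℤ) (x : Fn M) : S.ghp V p q (S.rho'.conj * x) =
    S.ghp V (-1) (-1) S.rho'.conj * x + S.rho'.conj * S.ghp V (p - -1) (q - -1) x :=
  S.ghp_mul V p q (-1) (-1) _ _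

theorem ghp_conj_tau'_mul (V : VF M) (p q : ℤ) (x : Fn M) : S.ghp V p q (S.tau'.conj * x) =
    S.ghp V 1 (-1) S.tau'.conj * x + S.tau'.conj * S.ghp V (p - 1) (q - -1) x :=
  S.ghp_mul V p q 1 (-1) _ _

theorem ghp_conj_sigma'_mul (V : VF M) (p q : ℤ) (x : Fn M) : S.ghp V p q (S.sigma'.conj * x) =
    S.ghp V 1 (-3) S.sigma'.conj * x + S.sigma'.conj * S.ghp V (p - 1) (q - -3) x :=
  S.ghp_mul V p q 1 (-3) _ _

theorem ghp_zero_weight_mul (V : VF M) (p q : ℤ) (y x : Fn M) : S.ghp V p q (y * x) =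
    V y * x + y * S.ghp V p q x := by
  rw [S.ghp_mul V p q 0 0, ghp_eq]
  simp only [Int.cast_zero, zero_mul, sub_zero]

variable {S} {L P N : Fn M}

theorem GHPEquations.tho_conj_rho (h : S.GHPEquations L P N) :
    S.ghp S.l 1 1 S.rho.conj = S.rho.conj * S.rho.conj := by
  have := congrArg Fn.conj h.tho_rho
  rwa [ghp_conj, conj_l, Fn.conj_mul] at this

theorem GHPEquations.tho_conj_tau (h : S.GHPEquations L P N) :
    S.ghp S.l (-1) 1 S.tau.conj = S.rho.conj * (S.tau.conj - S.tau') := by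
  have := congrArg Fn.conj h.tho_tau
  rwa [ghp_conj, conj_l, Fn.conj_mul, Fn.conj_sub, Fn.conj_conj] at this

theorem GHPEquations.tho'_conj_rho (h : S.GHPEquations L P N) :
    S.ghp S.n 1 1 S.rho.conj = S.rho.conj * S.rho' - S.tau.conj * S.tau - P.conj - 2 * L
      + S.ghp S.m (-1) 1 S.tau.conj := by
  have := congrArg Fn.conj h.tho'_rho
  simp only [ghp_conj, conj_n, conj_mb, Fn.conj_mul, Fn.conj_sub, Fn.conj_conj, Fn.conj_ofNat,
    h.conj_L] at this
  linear_combination this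

theorem GHPEquations.tho_conj_rho' (h : S.GHPEquations L P N) :
    S.ghp S.l (-1) (-1) S.rho'.conj = S.rho'.conj * S.rho - S.tau'.conj * S.tau' - P.conj - 2 * L
      + S.ghp S.mb 1 (-1) S.tau'.conj := by
  have := congrArg Fn.conj h.tho_rho'
  simp only [ghp_conj, conj_l, conj_m, Fn.conj_mul, Fn.conj_sub, Fn.conj_conj, Fn.conj_ofNat,
    h.conj_L] at this
  linear_combination this

theorem GHPEquations.edt_conj_rho' (h : S.GHPEquations L P N) :
    S.ghp S.m (-1) (-1) S.rho'.conj = (S.rho'.conj - S.rho') * S.tau'.conj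
      + (S.rho - S.rho.conj) * S.kappa'.conj - N.conj + S.ghp S.mb 1 (-3) S.sigma'.conj := by
  have := congrArg Fn.conj h.edt'_rho'
  simp only [ghp_conj, conj_mb, conj_m, Fn.conj_mul, Fn.conj_sub, Fn.conj_add, Fn.conj_conj]
    at this
  linear_combination this

theorem GHPEquations.tho_conj_sigma' (h : S.GHPEquations L P N) :
    S.ghp S.l 1 (-3) S.sigma'.conj = S.rho.conj * S.sigma'.conj - S.tau'.conj * S.tau'.conj
      + S.ghp S.m 1 (-1) S.tau'.conj := by
  have := congrArg Fn.conj h.tho_sigma'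
  simp only [ghp_conj, conj_mb, conj_l, Fn.conj_mul, Fn.conj_sub] at this
  linear_combination this

variable (S)

/-- The scalar `w = τ þχ - ρ ðχ`. -/
def debyeW (χ : Fn M) : Fn M := S.tau * S.ghp S.l (-4) 0 χ - S.rho * S.ghp S.m (-4) 0 χ

/-- The components of `(P + c t)^{A'} q_{A'}` for `P_{A'} = (þ, ð)`, `t_{A'} = (ρ, τ)`, where `q₀`
has weight `{p, q}` and `q₁` weight `{p, q - 2}`. -/
def divP (c : Fn M) (p q : ℤ) (q₀ q₁ : Fn M) : Fn M :=
  S.ghp S.m p q q₀ + S.rho.conj * q₁ + c * S.tau * q₀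
    - S.ghp S.l p (q - 2) q₁ - S.tau'.conj * q₀ - c * S.rho * q₁

/-- The components of `(Q - y)^{A'} q_{A'}` for `Q_{A'} = (ð', þ')`, `y_{A'} = -(τ', ρ')`. -/
def divQ (q₀ q₁ : Fn M) : Fn M :=
  S.ghp S.n (-1) 1 q₀ + S.tau.conj * q₁ + S.rho' * q₀
    - S.ghp S.mb (-1) (-1) q₁ - S.rho'.conj * q₀ - S.tau' * q₁

variable {S}

theorem GHPEquations.divP_divP (h : S.GHPEquations L P N) (y : Fn M) :
    S.divP 2 (-1) 1 (S.ghp S.l (-2) 0 y + 2 * S.rho * y) (S.ghp S.m (-2) 0 y + 2 * S.tau * y)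
      = 0 := by
  have c0 := h.comm_lm (-2) 0 y
  simp only [Int.reduceNeg, Int.reduceAdd, Int.reduceSub, Int.cast_zero] at c0
  simp only [divP, mul_assoc, ghp_add, ghp_ofNat_mul, ghp_rho_mul, ghp_tau_mul,
    h.tho_tau, h.edt_rho, Int.reduceNeg, Int.reduceSub]
  linear_combination -c0

theorem GHPEquations.wave_identity (h : S.GHPEquations L P N) (y : Fn M) :
    S.divP 3 (-3) 1 (S.ghp S.mb (-2) 0 y) (S.ghp S.n (-2) 0 y)
      + S.divQ (S.ghp S.l (-2) 0 y + 2 * S.rho * y) (S.ghp S.m (-2) 0 y + 2 * S.tau * y)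
      = -6 * P * y := by
  have c0 := h.comm_ln (-2) 0 y
  have c1 := h.comm_mmb (-2) 0 y
  simp only [Int.reduceNeg, Int.reduceAdd, Int.reduceSub, Int.cast_zero, Int.cast_neg,
    Int.cast_ofNat] at c0 c1
  simp only [divP, divQ, mul_assoc, ghp_add, ghp_ofNat_mul, ghp_rho_mul, ghp_tau_mul,
    Int.reduceNeg, Int.reduceSub]
  linear_combination -c0 + c1 + 2 * y * h.tho'_rho

theorem GHPEquations.divP_debyeF (h : S.GHPEquations L P N) (χ : Fn M) :
    S.divP 3 (-3) 1 ((P + 2 * L) * S.ghp S.l (-4) 0 χ + 6 * L * S.rho * χ)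
      ((P + 2 * L) * S.ghp S.m (-4) 0 χ + 6 * L * S.tau * χ) = 6 * P * S.debyeW χ := by
  have c0 := h.comm_lm (-4) 0 χ
  simp only [Int.reduceNeg, Int.reduceAdd, Int.reduceSub, Int.cast_zero] at c0
  simp only [divP, debyeW, mul_assoc, ghp_add, ghp_ofNat_mul,
    S.ghp_zero_weight_mul _ _ _ (P + 2 * L), S.ghp_zero_weight_mul _ _ _ L, map_add,
    VF.apply_ofNat_mul, h.const, h.l_Psi, h.m_Psi, ghp_rho_mul, ghp_tau_mul,
    h.tho_tau, h.edt_rho, Int.reduceNeg, Int.reduceSub]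
  linear_combination -(P + 2 * L) * c0

end SpinDyad

end Debye

end

noncomputable section

namespace Debye

namespace SpinDyad

variable {M : Type*} [TopologicalSpace M] [ChartedSpace (EuclideanSpace ℝ (Fin 4)) M]
  {g : LorentzMetric M} {S : SpinDyad g} {L P N : Fn M}

/-! ### First contracted derivatives of the Debye metric -/

theorem GHPEquations.contrP_zero (h : S.GHPEquations L P N) (χ : Fn M) :
    S.ghp S.m (-2) 2 (S.hmbmb χ) + 2 * S.rho.conj * S.hnmb χ + 2 * S.tau * S.hmbmb χ
      - S.ghp S.l (-2) 0 (S.hnmb χ) - S.tau'.conj * S.hmbmb χ - 2 * S.rho * S.hnmb χ =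
    -(S.ghp S.l (-2) 0 (S.debyeW χ) + 2 * S.rho * S.debyeW χ) := by
  have c0 := sub_eq_iff_eq_add.1 (h.comm_lm (-4) 0 χ)
  have c1 := sub_eq_iff_eq_add.1 (h.comm_lm (-3) 1 (S.ghp S.l (-4) 0 χ))
  simp only [Int.reduceNeg, Int.reduceAdd, Int.reduceSub, Int.cast_zero, Int.cast_one, zero_mul,
    add_zero] at c0 c1
  simp only [hmbmb, hnmb, debyeW, tho, edt, mul_assoc, ghp_add, ghp_sub, ghp_neg, ghp_ofNat_mul,
    ghp_rho_mul, ghp_tau_mul, ghp_conj_rho_mul, ghp_conj_tau'_mul, c0, c1, add_mul, h.tho_rho,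
    h.tho_conj_rho, h.tho_tau, h.edt_rho, Int.reduceNeg, Int.reduceSub]
  ring

theorem GHPEquations.contrP_one (h : S.GHPEquations L P N) (χ : Fn M) :
    S.ghp S.m (-2) 0 (S.hnmb χ) + S.sigma'.conj * S.hmbmb χ + S.rho.conj * S.hnn χ
      + 2 * S.tau * S.hnmb χ - S.ghp S.l (-2) (-2) (S.hnn χ) - 2 * S.tau'.conj * S.hnmb χ
      - 2 * S.rho * S.hnn χ =
    -(S.ghp S.m (-2) 0 (S.debyeW χ) + 2 * S.tau * S.debyeW χ) := by
  have c0 := (sub_eq_iff_eq_add'.1 (h.comm_lm (-4) 0 χ))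
  have c1 := sub_eq_iff_eq_add.1 (h.comm_lm (-3) (-1) (S.ghp S.m (-4) 0 χ))
  simp only [Int.reduceNeg, Int.reduceAdd, Int.reduceSub, Int.cast_zero, Int.cast_one, zero_mul,
    add_zero, Int.cast_neg] at c0 c1
  replace c0 := eq_sub_of_add_eq c0.symm
  simp only [hmbmb, hnmb, hnn, debyeW, tho, edt, mul_assoc, ghp_add, ghp_sub, ghp_neg,
    ghp_ofNat_mul, ghp_conj_sigma'_mul, h.tho_conj_sigma',
    ghp_rho_mul, ghp_tau_mul, ghp_conj_tau'_mul, c0, c1, add_mul, h.tho_tau, h.edt_rho, h.edt_tau, Int.reduceNeg, Int.reduceSub]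
  ring

theorem GHPEquations.debye_wave (h : S.GHPEquations L S.Psi2 N) {χ : Fn M}
    (hχ : S.debyeOp χ = 0) : S.ghp S.n (-3) 1 (S.ghp S.l (-4) 0 χ) =
      S.ghp S.mb (-3) (-1) (S.ghp S.m (-4) 0 χ) + 3 * (S.tau * S.ghp S.mb (-4) 0 χ)
      - 3 * (S.rho * S.ghp S.n (-4) 0 χ) + S.rho'.conj * S.ghp S.l (-4) 0 χ
      - S.tau.conj * S.ghp S.m (-4) 0 χ + 6 * (S.Psi2 * χ) + 6 * (L * χ) := by
  have hχ' := Fn.two_mul_cancel (hχ.trans (mul_zero (2 : Fn M)).symm)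
  simp only [tho, edt, tho', edt', mul_assoc, ghp_add, ghp_ofNat_mul, ghp_rho_mul, ghp_tau_mul,
    Int.reduceNeg, Int.reduceSub] at hχ'
  linear_combination hχ' - 3 * χ * h.tho'_rho

theorem GHPEquations.contrQ_zero (h : S.GHPEquations L S.Psi2 N) {χ : Fn M}
    (hχ : S.debyeOp χ = 0) :
    S.ghp S.n (-2) 2 (S.hmbmb χ) + 2 * S.tau.conj * S.hnmb χ - S.ghp S.mb (-2) 0 (S.hnmb χ)
      - S.rho'.conj * S.hmbmb χ =
    -(S.ghp S.mb (-2) 0 (S.debyeW χ) + (S.Psi2 + 2 * L) * S.ghp S.l (-4) 0 χ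
      + 6 * L * S.rho * χ) := by
  have hw := h.debye_wave hχ
  have c0 := sub_eq_iff_eq_add'.1 (h.comm_lm (-4) 0 χ)
  have c1 := sub_eq_iff_eq_add'.1 (h.comm_ln (-3) 1 (S.ghp S.l (-4) 0 χ))
  have c2 := sub_eq_iff_eq_add.1 (h.comm_lmb (-3) (-1) (S.ghp S.m (-4) 0 χ))
  have c3 := sub_eq_iff_eq_add.1 (h.comm_ln (-4) 0 χ)
  have c4 := sub_eq_iff_eq_add.1 (h.comm_lmb (-4) 0 χ)
  simp only [Int.reduceNeg, Int.reduceAdd, Int.reduceSub, Int.cast_zero, Int.cast_one, zero_mul,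
    add_zero, Int.cast_neg, Int.cast_ofNat] at c0 c1 c2 c3 c4
  replace c0 := eq_sub_of_add_eq c0.symm
  replace c1 := eq_sub_of_add_eq c1.symm
  have r0 := sub_eq_iff_eq_add.1 h.tho'_rho
  simp only [hmbmb, hnmb, debyeW, tho, edt, mul_assoc, ghp_add, ghp_sub, ghp_neg,
    ghp_ofNat_mul, ghp_rho_mul, ghp_tau_mul, ghp_conj_tau'_mul,
    ghp_conj_tau_mul, ghp_conj_rho'_mul, S.ghp_zero_weight_mul _ _ _ S.Psi2,
    S.ghp_zero_weight_mul _ _ _ L, h.const, h.l_Psi, hw,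
    c0, c1, c2, c3, c4, r0, add_mul, sub_mul, h.tho_rho, h.tho_conj_rho', h.tho_conj_tau,
    h.tho_tau, Int.reduceNeg, Int.reduceSub]
  ring

theorem GHPEquations.contrQ_one (h : S.GHPEquations L S.Psi2 N) {χ : Fn M}
    (hχ : S.debyeOp χ = 0) :
    S.ghp S.n (-2) 0 (S.hnmb χ) + S.kappa'.conj * S.hmbmb χ + S.tau.conj * S.hnn χ
      - S.ghp S.mb (-2) (-2) (S.hnn χ) - 2 * S.rho'.conj * S.hnmb χ =
    -(S.ghp S.n (-2) 0 (S.debyeW χ) + (S.Psi2 + 2 * L) * S.ghp S.m (-4) 0 χ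
      + 6 * L * S.tau * χ) := by
  have hw := h.debye_wave hχ
  have c0 := sub_eq_iff_eq_add.1 (h.comm_lm (-4) 0 χ)
  have c1 := sub_eq_iff_eq_add.1 (h.comm_nm (-3) 1 (S.ghp S.l (-4) 0 χ))
  have c2 := sub_eq_iff_eq_add.1 (h.comm_mmb (-3) (-1) (S.ghp S.m (-4) 0 χ))
  have c3 := sub_eq_iff_eq_add.1 (h.comm_mmb (-4) 0 χ)
  have c4 := sub_eq_iff_eq_add.1 (h.comm_nm (-4) 0 χ)
  simp only [Int.reduceNeg, Int.reduceAdd, Int.reduceSub, Int.cast_zero, Int.cast_one, zero_mul,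
    add_zero, Int.cast_neg, Int.cast_ofNat] at c0 c1 c2 c3 c4
  have r0 := sub_eq_iff_eq_add.1 h.tho'_rho
  simp only [hmbmb, hnmb, hnn, debyeW, tho, edt, mul_assoc, ghp_add, ghp_sub, ghp_neg,
    ghp_ofNat_mul, ghp_rho_mul, ghp_tau_mul, ghp_conj_rho_mul, ghp_conj_tau'_mul,
    ghp_conj_tau_mul, ghp_conj_rho'_mul, ghp_conj_sigma'_mul, S.ghp_zero_weight_mul _ _ _ S.Psi2,
    S.ghp_zero_weight_mul _ _ _ L, h.const, h.m_Psi, hw,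
    c0, c1, c2, c3, c4, r0, add_mul, sub_mul, h.edt_rho, h.edt_conj_rho',
    h.tho'_conj_rho, h.edt_tau, Int.reduceNeg, Int.reduceSub]
  ring

end SpinDyad

end Debye

end

noncomputable section

namespace Debye

namespace SpinDyad

variable {M : Type*} [TopologicalSpace M] [ChartedSpace (EuclideanSpace ℝ (Fin 4)) M]
  {g : LorentzMetric M} (S : SpinDyad g)

/-! ### Second derivatives of a metric perturbation `o_A o_B X_{A'B'}` -/

/-- The symmetric tensor `x₂ l l - x₁ (l m + m l) + x₀ m m`. -/
def nullTwo (x₀ x₁ x₂ : Fn M) (X Y : VF M) : Fn M :=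
  x₂ * (g.toForm S.l X * g.toForm S.l Y)
    - x₁ * (g.toForm S.l X * g.toForm S.m Y + g.toForm S.m X * g.toForm S.l Y)
    + x₀ * (g.toForm S.m X * g.toForm S.m Y)

theorem debyeMetric_eq (χ : Fn M) :
    S.debyeMetric χ = S.nullTwo (S.hmbmb χ) (S.hnmb χ) (S.hnn χ) := rfl

theorem aForm_sub (V W : VF M) : S.aForm (V - W) = S.aForm V - S.aForm W := by
  rw [sub_eq_add_neg, aForm_add, aForm_neg, sub_eq_add_neg]

theorem spinConn_sub (V W : VF M) : S.spinConn (V - W) = S.spinConn V - S.spinConn W := by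
  rw [sub_eq_add_neg, spinConn_add, spinConn_neg, sub_eq_add_neg]

theorem spinConnC_sub (V W : VF M) : S.spinConnC (V - W) = S.spinConnC V - S.spinConnC W := by
  rw [eq_sub_iff_add_eq, ← spinConnC_add, sub_add_cancel]

theorem aFormC_sub (V W : VF M) : S.aFormC (V - W) = S.aFormC V - S.aFormC W := by
  rw [eq_sub_iff_add_eq, ← aFormC_add, sub_add_cancel]

theorem bFormC_sub (V W : VF M) : S.bFormC (V - W) = S.bFormC V - S.bFormC W := by
  rw [eq_sub_iff_add_eq, ← bFormC_add, sub_add_cancel]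

theorem apply_form_l (V Z : VF M) : V (g.toForm S.l Z) =
    (S.spinConn V + S.spinConnC V) * g.toForm S.l Z + S.aForm V * g.toForm S.mb Z
      + S.aFormC V * g.toForm S.m Z + g.toForm S.l (S.nabla V Z) := by
  rw [S.nabla_metric, nabla_l]
  simp only [map_add, map_smul, LinearMap.add_apply, LinearMap.smul_apply, smul_eq_mul]

theorem apply_form_m (V Z : VF M) : V (g.toForm S.m Z) =
    (S.spinConn V - S.spinConnC V) * g.toForm S.m Z + S.aForm V * g.toForm S.n Z
      + S.bFormC V * g.toForm S.l Z + g.toForm S.m (S.nabla V Z) := by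
  rw [S.nabla_metric, nabla_m]
  simp only [map_add, map_smul, LinearMap.add_apply, LinearMap.smul_apply, smul_eq_mul]

theorem nablaTwo_nullTwo (x₀ x₁ x₂ : Fn M) (V Z W : VF M) :
    S.nablaTwo (S.nullTwo x₀ x₁ x₂) V Z W =
      (V x₂ + 2 * (S.spinConn V + S.spinConnC V) * x₂ - 2 * S.bFormC V * x₁)
        * (g.toForm S.l Z * g.toForm S.l W)
      - (V x₁ + 2 * S.spinConn V * x₁ - S.aFormC V * x₂ - S.bFormC V * x₀)
        * (g.toForm S.l Z * g.toForm S.m W + g.toForm S.m Z * g.toForm S.l W)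
      + (V x₀ + 2 * (S.spinConn V - S.spinConnC V) * x₀ - 2 * S.aFormC V * x₁)
        * (g.toForm S.m Z * g.toForm S.m W)
      + S.aForm V * (x₂ * (g.toForm S.l Z * g.toForm S.mb W + g.toForm S.mb Z * g.toForm S.l W)
        - x₁ * (g.toForm S.l Z * g.toForm S.n W + g.toForm S.n Z * g.toForm S.l W
          + g.toForm S.m Z * g.toForm S.mb W + g.toForm S.mb Z * g.toForm S.m W)
        + x₀ * (g.toForm S.m Z * g.toForm S.n W + g.toForm S.n Z * g.toForm S.m W)) := by
  simp only [nablaTwo, nullTwo, map_add, map_sub, VF.apply_mul, apply_form_l, apply_form_m]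
  ring

theorem nablaNablaContr_eq (h : VF M → VF M → Fn M) (A B C D : Fin 2) :
    S.nablaNablaContr h ![A, B, C, D] =
      S.nablaThree (S.nablaTwo h) (S.e A 1) (S.e B 1) (S.e C 0) (S.e D 0)
      - S.nablaThree (S.nablaTwo h) (S.e A 1) (S.e B 0) (S.e C 0) (S.e D 1)
      - S.nablaThree (S.nablaTwo h) (S.e A 0) (S.e B 1) (S.e C 1) (S.e D 0)
      + S.nablaThree (S.nablaTwo h) (S.e A 0) (S.e B 0) (S.e C 1) (S.e D 1) := by
  simp [nablaNablaContr, Fin.sum_univ_two, eps]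
  ring

theorem traceTwo_nullTwo (x₀ x₁ x₂ : Fn M) : S.traceTwo (S.nullTwo x₀ x₁ x₂) = 0 := by
  have h : S.traceTwo (S.nullTwo x₀ x₁ x₂) = S.nullTwo x₀ x₁ x₂ S.l S.n
    + S.nullTwo x₀ x₁ x₂ S.n S.l - S.nullTwo x₀ x₁ x₂ S.m S.mb
    - S.nullTwo x₀ x₁ x₂ S.mb S.m := sum_eps fun A A' B B' =>
      S.nullTwo x₀ x₁ x₂ (S.e A A') (S.e B B')
  rw [h]
  simp only [nullTwo, form_ll, form_lm, form_lmb, form_mm, form_ml]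
  ring

theorem sum_perm_zero (T : (Fin 4 → Fin 2) → Fn M) :
    ∑ π : Equiv.Perm (Fin 4), T (![0, 0, 0, 0] ∘ π) = 24 * T ![0, 0, 0, 0] := by
  rw [Finset.sum_comp T (fun π : Equiv.Perm (Fin 4) => ![(0 : Fin 2), 0, 0, 0] ∘ π),
    show Finset.univ.image (fun π : Equiv.Perm (Fin 4) => ![(0 : Fin 2), 0, 0, 0] ∘ π) =
      {![0, 0, 0, 0]} by decide +kernel, Finset.sum_singleton,
    show (Finset.univ.filter fun π : Equiv.Perm (Fin 4) =>
      ![(0 : Fin 2), 0, 0, 0] ∘ π = ![0, 0, 0, 0]).card = 24 by decide +kernel]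
  simp

theorem sum_perm_three (T : (Fin 4 → Fin 2) → Fn M) :
    ∑ π : Equiv.Perm (Fin 4), T (![0, 1, 1, 1] ∘ π) =
      6 * (T ![0, 1, 1, 1] + T ![1, 0, 1, 1] + T ![1, 1, 0, 1] + T ![1, 1, 1, 0]) := by
  have hc : ∀ j ∈ ({![0, 1, 1, 1], ![1, 0, 1, 1], ![1, 1, 0, 1], ![1, 1, 1, 0]} :
      Finset (Fin 4 → Fin 2)), (Finset.univ.filter fun π : Equiv.Perm (Fin 4) =>
      ![(0 : Fin 2), 1, 1, 1] ∘ π = j).card = 6 := by decide +kernel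
  rw [Finset.sum_comp T (fun π : Equiv.Perm (Fin 4) => ![(0 : Fin 2), 1, 1, 1] ∘ π),
    show Finset.univ.image (fun π : Equiv.Perm (Fin 4) => ![(0 : Fin 2), 1, 1, 1] ∘ π) =
      {![0, 1, 1, 1], ![1, 0, 1, 1], ![1, 1, 0, 1], ![1, 1, 1, 0]} by decide +kernel,
    Finset.sum_congr rfl (fun j hj => by rw [hc j hj]), ← Finset.smul_sum]
  rw [Finset.sum_insert (by decide), Finset.sum_insert (by decide), Finset.sum_insert (by decide),
    Finset.sum_singleton]
  simp
  ring

theorem sum_perm_one (T : (Fin 4 → Fin 2) → Fn M) :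
    ∑ π : Equiv.Perm (Fin 4), T (![0, 0, 0, 1] ∘ π) =
      6 * (T ![0, 0, 0, 1] + T ![0, 0, 1, 0] + T ![0, 1, 0, 0] + T ![1, 0, 0, 0]) := by
  have hc : ∀ j ∈ ({![0, 0, 0, 1], ![0, 0, 1, 0], ![0, 1, 0, 0], ![1, 0, 0, 0]} :
      Finset (Fin 4 → Fin 2)), (Finset.univ.filter fun π : Equiv.Perm (Fin 4) =>
      ![(0 : Fin 2), 0, 0, 1] ∘ π = j).card = 6 := by decide +kernel
  rw [Finset.sum_comp T (fun π : Equiv.Perm (Fin 4) => ![(0 : Fin 2), 0, 0, 1] ∘ π),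
    show Finset.univ.image (fun π : Equiv.Perm (Fin 4) => ![(0 : Fin 2), 0, 0, 1] ∘ π) =
      {![0, 0, 0, 1], ![0, 0, 1, 0], ![0, 1, 0, 0], ![1, 0, 0, 0]} by decide +kernel,
    Finset.sum_congr rfl (fun j hj => by rw [hc j hj]), ← Finset.smul_sum]
  rw [Finset.sum_insert (by decide), Finset.sum_insert (by decide), Finset.sum_insert (by decide),
    Finset.sum_singleton]
  simp
  ring

theorem sum_perm_two (T : (Fin 4 → Fin 2) → Fn M) :
    ∑ π : Equiv.Perm (Fin 4), T (![0, 0, 1, 1] ∘ π) =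
      4 * (T ![0, 0, 1, 1] + T ![0, 1, 0, 1] + T ![0, 1, 1, 0] + T ![1, 0, 0, 1]
        + T ![1, 0, 1, 0] + T ![1, 1, 0, 0]) := by
  have hc : ∀ j ∈ ({![0, 0, 1, 1], ![0, 1, 0, 1], ![0, 1, 1, 0], ![1, 0, 0, 1], ![1, 0, 1, 0],
      ![1, 1, 0, 0]} : Finset (Fin 4 → Fin 2)), (Finset.univ.filter fun π : Equiv.Perm (Fin 4) =>
      ![(0 : Fin 2), 0, 1, 1] ∘ π = j).card = 4 := by decide +kernel
  rw [Finset.sum_comp T (fun π : Equiv.Perm (Fin 4) => ![(0 : Fin 2), 0, 1, 1] ∘ π),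
    show Finset.univ.image (fun π : Equiv.Perm (Fin 4) => ![(0 : Fin 2), 0, 1, 1] ∘ π) =
      {![0, 0, 1, 1], ![0, 1, 0, 1], ![0, 1, 1, 0], ![1, 0, 0, 1], ![1, 0, 1, 0],
      ![1, 1, 0, 0]} by decide +kernel,
    Finset.sum_congr rfl (fun j hj => by rw [hc j hj]), ← Finset.smul_sum]
  rw [Finset.sum_insert (by decide), Finset.sum_insert (by decide), Finset.sum_insert (by decide),
    Finset.sum_insert (by decide), Finset.sum_insert (by decide), Finset.sum_singleton]
  simp
  ring

end SpinDyad

end Debye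

end

noncomputable section

namespace Debye

namespace SpinDyad

variable {M : Type*} [TopologicalSpace M] [ChartedSpace (EuclideanSpace ℝ (Fin 4)) M]
  {g : LorentzMetric M} {S : SpinDyad g}

section Contraction

set_option linter.unusedSimpArgs false

theorem nablaNablaContr_zero (hl : S.aForm S.l = 0) (hm : S.aForm S.m = 0) (x₀ x₁ x₂ : Fn M) :
    S.nablaNablaContr (S.nullTwo x₀ x₁ x₂) ![0, 0, 0, 0] = 0 ∧
    S.nablaNablaContr (S.nullTwo x₀ x₁ x₂) ![0, 0, 0, 1] = 0 ∧
    S.nablaNablaContr (S.nullTwo x₀ x₁ x₂) ![0, 0, 1, 0] = 0 ∧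
    S.nablaNablaContr (S.nullTwo x₀ x₁ x₂) ![0, 1, 0, 0] = 0 ∧
    S.nablaNablaContr (S.nullTwo x₀ x₁ x₂) ![1, 0, 0, 0] = 0 := by
  refine ⟨?_, ?_, ?_, ?_, ?_⟩ <;>
  · simp only [nablaNablaContr_eq, e_zero_zero, e_zero_one, e_one_zero, e_one_one, nablaThree,
      nablaTwo_nullTwo, nabla_l, nabla_n, nabla_m, nabla_mb, map_add, map_sub, map_smul,
      smul_eq_mul, form_ll, form_lm, form_lmb, form_ln, form_nl, form_nm, form_nmb, form_nn,
      form_ml, form_mm, form_mmb, form_mn, form_mbl, form_mbm, form_mbmb, form_mbn, hl, hm,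
      aForm_add, aForm_sub, aForm_smul, mul_zero, zero_mul, map_zero, add_zero, zero_add, sub_zero, mul_one, zero_smul]
    try ring

set_option maxHeartbeats 1000000 in
theorem nablaNablaContr_two (hl : S.aForm S.l = 0) (hm : S.aForm S.m = 0) (x₀ x₁ x₂ : Fn M) :
    S.nablaNablaContr (S.nullTwo x₀ x₁ x₂) ![0, 0, 1, 1]
      + S.nablaNablaContr (S.nullTwo x₀ x₁ x₂) ![0, 1, 0, 1]
      + S.nablaNablaContr (S.nullTwo x₀ x₁ x₂) ![0, 1, 1, 0]
      + S.nablaNablaContr (S.nullTwo x₀ x₁ x₂) ![1, 0, 0, 1]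
      + S.nablaNablaContr (S.nullTwo x₀ x₁ x₂) ![1, 0, 1, 0]
      + S.nablaNablaContr (S.nullTwo x₀ x₁ x₂) ![1, 1, 0, 0] =
    S.divP 2 (-1) 1
      (S.ghp S.m (-2) 2 x₀ + 2 * S.rho.conj * x₁ + 2 * S.tau * x₀
        - S.ghp S.l (-2) 0 x₁ - S.tau'.conj * x₀ - 2 * S.rho * x₁)
      (S.ghp S.m (-2) 0 x₁ + S.sigma'.conj * x₀ + S.rho.conj * x₂
        + 2 * S.tau * x₁ - S.ghp S.l (-2) (-2) x₂ - 2 * S.tau'.conj * x₁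
        - 2 * S.rho * x₂) := by
  have hlc : S.aFormC S.l = 0 := by rw [← S.conj_l, ← conj_aForm, hl, Fn.conj_zero]
  have hmc : S.aFormC S.mb = 0 := by rw [← S.conj_m, ← conj_aForm, hm, Fn.conj_zero]
  simp only [nablaNablaContr_eq, e_zero_zero, e_zero_one, e_one_zero, e_one_one, nablaThree,
    nablaTwo_nullTwo, nabla_l, nabla_n, nabla_m, nabla_mb, map_add, map_sub, map_smul,
    smul_eq_mul, form_ll, form_lm, form_lmb, form_ln, form_nl, form_nm, form_nmb, form_nn,
    form_ml, form_mm, form_mmb, form_mn, form_mbl, form_mbm, form_mbmb, form_mbn, hl, hm, hlc, hmc,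
    mul_zero, zero_mul, map_zero, add_zero, zero_add, sub_zero, mul_one, zero_smul, mul_neg,
    neg_mul, map_neg, Derivation.add_apply, Derivation.sub_apply, Derivation.smul_apply,
    spinConn_add, spinConn_sub, spinConn_smul, spinConnC_add, spinConnC_sub, spinConnC_smul,
    aForm_add, aForm_sub, aForm_smul, aFormC_add, aFormC_sub, aFormC_smul, bFormC_add, bFormC_sub,
    bFormC_smul, aForm_mb, aForm_n, bForm_l, bForm_n, bForm_m,
    bForm_mb, aFormC_m, aFormC_n, bFormC_l, bFormC_n, bFormC_m, bFormC_mb, VF.apply_mul,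
    VF.apply_ofNat, divP, ghp_eq, Int.reduceNeg, Int.reduceSub, Int.cast_neg, Int.cast_ofNat,
    Int.cast_one, Int.cast_zero]
  ring

set_option maxHeartbeats 1000000 in
theorem nablaNablaContr_three (hl : S.aForm S.l = 0) (hm : S.aForm S.m = 0) (x₀ x₁ x₂ : Fn M) :
    S.nablaNablaContr (S.nullTwo x₀ x₁ x₂) ![0, 1, 1, 1]
      + S.nablaNablaContr (S.nullTwo x₀ x₁ x₂) ![1, 0, 1, 1]
      + S.nablaNablaContr (S.nullTwo x₀ x₁ x₂) ![1, 1, 0, 1]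
      + S.nablaNablaContr (S.nullTwo x₀ x₁ x₂) ![1, 1, 1, 0] =
    S.divP 3 (-3) 1
      (S.ghp S.n (-2) 2 x₀ + 2 * S.tau.conj * x₁ - S.ghp S.mb (-2) 0 x₁ - S.rho'.conj * x₀)
      (S.ghp S.n (-2) 0 x₁ + S.kappa'.conj * x₀ + S.tau.conj * x₂
        - S.ghp S.mb (-2) (-2) x₂ - 2 * S.rho'.conj * x₁)
    + S.divQ
      (S.ghp S.m (-2) 2 x₀ + 2 * S.rho.conj * x₁ + 2 * S.tau * x₀
        - S.ghp S.l (-2) 0 x₁ - S.tau'.conj * x₀ - 2 * S.rho * x₁)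
      (S.ghp S.m (-2) 0 x₁ + S.sigma'.conj * x₀ + S.rho.conj * x₂
        + 2 * S.tau * x₁ - S.ghp S.l (-2) (-2) x₂ - 2 * S.tau'.conj * x₁
        - 2 * S.rho * x₂) := by
  have hlc : S.aFormC S.l = 0 := by rw [← S.conj_l, ← conj_aForm, hl, Fn.conj_zero]
  have hmc : S.aFormC S.mb = 0 := by rw [← S.conj_m, ← conj_aForm, hm, Fn.conj_zero]
  simp only [nablaNablaContr_eq, e_zero_zero, e_zero_one, e_one_zero, e_one_one, nablaThree,
    nablaTwo_nullTwo, nabla_l, nabla_n, nabla_m, nabla_mb, map_add, map_sub, map_smul,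
    smul_eq_mul, form_ll, form_lm, form_lmb, form_ln, form_nl, form_nm, form_nmb, form_nn,
    form_ml, form_mm, form_mmb, form_mn, form_mbl, form_mbm, form_mbmb, form_mbn, hl, hm, hlc, hmc,
    mul_zero, zero_mul, map_zero, add_zero, zero_add, sub_zero, mul_one, zero_smul, mul_neg,
    neg_mul, map_neg, Derivation.add_apply, Derivation.sub_apply, Derivation.smul_apply,
    spinConn_add, spinConn_sub, spinConn_smul, spinConnC_add, spinConnC_sub, spinConnC_smul,
    aForm_add, aForm_sub, aForm_smul, aFormC_add, aFormC_sub, aFormC_smul, bFormC_add, bFormC_sub,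
    bFormC_smul, aForm_mb, aForm_n, bForm_l, bForm_n, bForm_m,
    bForm_mb, aFormC_m, aFormC_n, bFormC_l, bFormC_n, bFormC_m, bFormC_mb, VF.apply_mul,
    VF.apply_ofNat, divP, divQ, ghp_eq, Int.reduceNeg, Int.reduceSub, Int.cast_neg, Int.cast_ofNat,
    Int.cast_one, Int.cast_zero]
  ring

end Contraction

end SpinDyad

end Debye

end

noncomputable section

namespace Debye

namespace SpinDyad

variable {M : Type*} [TopologicalSpace M] [ChartedSpace (EuclideanSpace ℝ (Fin 4)) M]
  {g : LorentzMetric M} {S : SpinDyad g}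

/-! ### The linearized Weyl spinor of the Debye metric -/

theorem IsTypeII.ghpEquations {Λ : ℝ} (hII : S.IsTypeII) (hE : S.IsEinstein Λ) :
    S.GHPEquations (algebraMap ℝ (Fn M) Λ) S.Psi2 (S.curvW S.mb S.n) :=
  (hE.frameCurvature hII.1 hII.2.1).ghpEquations hII.2.2 (Fn.conj_algebraMap Λ)

theorem linWeyl_debyeMetric (χ : Fn M) (i : Fin 4 → Fin 2) : S.linWeyl (S.debyeMetric χ) i =
    (1 / 2 : ℝ) • (1 / 24 : ℝ) •
      ∑ π : Equiv.Perm (Fin 4), S.nablaNablaContr (S.debyeMetric χ) (i ∘ π) := by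
  have h : S.traceTwo (S.debyeMetric χ) = 0 := by
    rw [debyeMetric_eq, traceTwo_nullTwo]
  rw [linWeyl, h, zero_mul, smul_zero, add_zero, sym4]

theorem linWeyl_debyeMetric_comp (χ : Fn M) (i : Fin 4 → Fin 2) (σ : Equiv.Perm (Fin 4)) :
    S.linWeyl (S.debyeMetric χ) (i ∘ σ) = S.linWeyl (S.debyeMetric χ) i := by
  rw [linWeyl_debyeMetric, linWeyl_debyeMetric]
  congr 2
  exact Fintype.sum_equiv (Equiv.mulLeft σ) _ _ fun π => rfl

variable {L N : Fn M}

theorem GHPEquations.linWeyl_zero {P : Fn M} (h : S.GHPEquations L P N) (χ : Fn M) :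
    S.linWeyl (S.debyeMetric χ) ![0, 0, 0, 0] = 0 := by
  rw [linWeyl_debyeMetric, sum_perm_zero, debyeMetric_eq,
    (nablaNablaContr_zero h.kappa h.sigma _ _ _).1, mul_zero, smul_zero, smul_zero]

theorem GHPEquations.linWeyl_one {P : Fn M} (h : S.GHPEquations L P N) (χ : Fn M) :
    S.linWeyl (S.debyeMetric χ) ![0, 0, 0, 1] = 0 := by
  obtain ⟨-, h1, h2, h3, h4⟩ :=
    nablaNablaContr_zero h.kappa h.sigma (S.hmbmb χ) (S.hnmb χ) (S.hnn χ)
  rw [linWeyl_debyeMetric, sum_perm_one, debyeMetric_eq, h1, h2, h3, h4, add_zero, add_zero,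
    add_zero, mul_zero, smul_zero, smul_zero]

theorem GHPEquations.linWeyl_two {P : Fn M} (h : S.GHPEquations L P N) (χ : Fn M) :
    S.linWeyl (S.debyeMetric χ) ![0, 0, 1, 1] = 0 := by
  have hp := h.divP_divP (S.debyeW χ)
  rw [linWeyl_debyeMetric, sum_perm_two, debyeMetric_eq, nablaNablaContr_two h.kappa h.sigma,
    h.contrP_zero, h.contrP_one]
  have hn : S.divP 2 (-1) 1 (-(S.ghp S.l (-2) 0 (S.debyeW χ) + 2 * S.rho * S.debyeW χ))
      (-(S.ghp S.m (-2) 0 (S.debyeW χ) + 2 * S.tau * S.debyeW χ)) = 0 := by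
    rw [divP] at hp ⊢
    rw [ghp_neg, ghp_neg]
    linear_combination -hp
  rw [hn, mul_zero, smul_zero, smul_zero]

theorem GHPEquations.linWeyl_three (h : S.GHPEquations L S.Psi2 N) {χ : Fn M}
    (hχ : S.debyeOp χ = 0) : S.linWeyl (S.debyeMetric χ) ![0, 1, 1, 1] = 0 := by
  have hw := h.wave_identity (S.debyeW χ)
  have hF := h.divP_debyeF χ
  rw [linWeyl_debyeMetric, sum_perm_three, debyeMetric_eq,
    nablaNablaContr_three h.kappa h.sigma, h.contrP_zero, h.contrP_one, h.contrQ_zero hχ,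
    h.contrQ_one hχ]
  have hn : S.divP 3 (-3) 1
      (-(S.ghp S.mb (-2) 0 (S.debyeW χ) + (S.Psi2 + 2 * L) * S.ghp S.l (-4) 0 χ
        + 6 * L * S.rho * χ))
      (-(S.ghp S.n (-2) 0 (S.debyeW χ) + (S.Psi2 + 2 * L) * S.ghp S.m (-4) 0 χ
        + 6 * L * S.tau * χ))
      + S.divQ (-(S.ghp S.l (-2) 0 (S.debyeW χ) + 2 * S.rho * S.debyeW χ))
        (-(S.ghp S.m (-2) 0 (S.debyeW χ) + 2 * S.tau * S.debyeW χ)) = 0 := by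
    simp only [divP, divQ, ghp_neg, ghp_add] at hw hF ⊢
    linear_combination -hw - hF
  rw [hn, mul_zero, smul_zero, smul_zero]

theorem exists_perm_comp_eq (i : Fin 4 → Fin 2) : ∃ σ : Equiv.Perm (Fin 4),
    i = ![0, 0, 0, 0] ∘ σ ∨ i = ![0, 0, 0, 1] ∘ σ ∨ i = ![0, 0, 1, 1] ∘ σ ∨
      i = ![0, 1, 1, 1] ∘ σ ∨ i = ![1, 1, 1, 1] := by
  revert i
  decide +kernel

theorem prod_oLower_comp (i : Fin 4 → Fin 2) (σ : Equiv.Perm (Fin 4)) :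
    ∏ k, oLower ((i ∘ σ) k) = ∏ k, oLower (i k) :=
  Equiv.prod_comp σ fun k => oLower (i k)

end SpinDyad

end Debye

end

theorem debye_metric_half_typeN {M : Type*} [TopologicalSpace M] [T2Space M]
    [SecondCountableTopology M] [ChartedSpace (EuclideanSpace ℝ (Fin 4)) M]
    [IsManifold (𝓡 4) ∞ M]
    (g : Debye.LorentzMetric M) (S : Debye.SpinDyad g) (Λ : ℝ)
    (hE : S.IsEinstein Λ) (hII : S.IsTypeII)
    (χ : Debye.Fn M) (hχ : S.debyeOp χ = 0) :
    (∀ i : Fin 4 → Fin 2, S.linWeyl (S.debyeMetric χ) i =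
      ((∏ k, Debye.SpinDyad.oLower (i k) : ℤ) : Debye.Fn M)
        * S.linWeyl (S.debyeMetric χ) ![1, 1, 1, 1]) ∧
    S.linWeyl (S.debyeMetric χ) ![0, 0, 0, 0] = 0 ∧
    S.linWeyl (S.debyeMetric χ) ![0, 0, 0, 1] = 0 ∧
    S.linWeyl (S.debyeMetric χ) ![0, 0, 1, 1] = 0 ∧
    S.linWeyl (S.debyeMetric χ) ![0, 1, 1, 1] = 0 := by
  have h := hII.ghpEquations hE
  have h0 := h.linWeyl_zero χ
  have h1 := h.linWeyl_one χ
  have h2 := h.linWeyl_two χ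
  have h3 := h.linWeyl_three hχ
  refine ⟨fun i => ?_, h0, h1, h2, h3⟩
  obtain ⟨σ, rfl | rfl | rfl | rfl | rfl⟩ := Debye.SpinDyad.exists_perm_comp_eq i
  · rw [Debye.SpinDyad.linWeyl_debyeMetric_comp, Debye.SpinDyad.prod_oLower_comp, h0]
    simp [Debye.SpinDyad.oLower, Fin.prod_univ_four]
  · rw [Debye.SpinDyad.linWeyl_debyeMetric_comp, Debye.SpinDyad.prod_oLower_comp, h1]
    simp [Debye.SpinDyad.oLower, Fin.prod_univ_four]
  · rw [Debye.SpinDyad.linWeyl_debyeMetric_comp, Debye.SpinDyad.prod_oLower_comp, h2]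
    simp [Debye.SpinDyad.oLower, Fin.prod_univ_four]
  · rw [Debye.SpinDyad.linWeyl_debyeMetric_comp, Debye.SpinDyad.prod_oLower_comp, h3]
    simp [Debye.SpinDyad.oLower, Fin.prod_univ_four]
  · simp [Debye.SpinDyad.oLower, Fin.prod_univ_four]
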